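/- arXiv:2406.12777 — 2 statements merged into one kernel-verified Lean document; each statement's English description precedes it below -/
import Mathlib

section
/- Every infinite, finitely generated and recursively presented group admits a nonempty effective subshift whose Medvedev degree is the maximal Π⁰₁ Medvedev degree (the maximum of the lattice of degrees of nonempty Π⁰₁ subsets of {0,1}^ℕ, namely the degree of the class of complete consistent extensions of Peano arithmetic). -/
namespace MedvedevFormal

/-! ### Medvedev reducibility on Baire space -/

/-- The finite prefix of length `k` of a point of Baire space, as a list. -/
def pref (x : ℕ → ℕ) (k : ℕ) : List ℕ := (List.range k).map x

/-- Medvedev reducibility `m(P) ≤ m(Q)` between subsets of Baire space: some computable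
monotone prefix-functional (i.e. a partial computable type-two functional), defined on all
of `Q`, maps every element of `Q` to an element of `P`. -/
def BaireLE (P Q : Set (ℕ → ℕ)) : Prop :=
  ∃ φ : List ℕ → List ℕ, Computable φ ∧
    (∀ l₁ l₂ : List ℕ, l₁ <+: l₂ → φ l₁ <+: φ l₂) ∧
    ∀ x ∈ Q, ∃ y ∈ P, ∀ n : ℕ, ∃ k : ℕ, (φ (pref x k))[n]? = some (y n)

/-- Medvedev equivalence: `m(P) = m(Q)`. -/
def BaireEquiv (P Q : Set (ℕ → ℕ)) : Prop := BaireLE P Q ∧ BaireLE Q P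

/-- A canonical representative of the join `m(P) ∨ m(Q)`. -/
def joinSet (P Q : Set (ℕ → ℕ)) : Set (ℕ → ℕ) :=
  {x | (fun n => x (2 * n)) ∈ P ∧ (fun n => x (2 * n + 1)) ∈ Q}

/-- A canonical representative of the meet `m(P) ∧ m(Q)`. -/
def meetSet (P Q : Set (ℕ → ℕ)) : Set (ℕ → ℕ) :=
  {x | (x 0 = 0 ∧ (fun n => x (n + 1)) ∈ P) ∨ (x 0 = 1 ∧ (fun n => x (n + 1)) ∈ Q)}

/-- `P` has the zero Medvedev degree `0_M`: it contains a computable point. -/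
def IsZeroDeg (P : Set (ℕ → ℕ)) : Prop := ∃ y ∈ P, Computable y

/-- The cylinder of a finite word in Baire space. -/
def cylinder (l : List ℕ) : Set (ℕ → ℕ) :=
  {x | ∀ (i : ℕ) (h : i < l.length), x i = l[i]}

/-- Cantor space `{0,1}^ℕ` inside Baire space. -/
def cantorSpace : Set (ℕ → ℕ) := {x | ∀ n, x n ≤ 1}

/-- `P` is an effectively closed (`Π⁰₁`) subset of Cantor space: its complement within
Cantor space is the union of the cylinders of a computably enumerable sequence of words. -/
def IsPi01Cantor (P : Set (ℕ → ℕ)) : Prop :=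
  ∃ f : ℕ → List ℕ, Computable f ∧ P = cantorSpace \ ⋃ n, cylinder (f n)

/-- The Medvedev degree of `P` is a `Π⁰₁` Medvedev degree. -/
def IsPi01Deg (P : Set (ℕ → ℕ)) : Prop :=
  ∃ Q, IsPi01Cantor Q ∧ Q.Nonempty ∧ BaireEquiv P Q

/-- `P` realizes the maximal `Π⁰₁` Medvedev degree (the degree of the class of complete
consistent extensions of Peano arithmetic): it is a nonempty `Π⁰₁` subset of Cantor space
to which every nonempty `Π⁰₁` subset of Cantor space is Medvedev reducible. -/
def IsMaxPi01 (P : Set (ℕ → ℕ)) : Prop :=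
  IsPi01Cantor P ∧ P.Nonempty ∧ ∀ Q, IsPi01Cantor Q → Q.Nonempty → BaireLE Q P

/-! ### Encoding of configuration spaces -/

/-- The canonical encoding of a configuration `x : α → A` as a point of Baire space. -/
def confFun {α A : Type*} [Encodable α] [Encodable A] (x : α → A) : ℕ → ℕ :=
  fun n => Encodable.encode ((Encodable.decode (α := α) n).map x)

/-- The image of a set of configurations in Baire space, used to measure its
Medvedev degree. -/
def mSet {α A : Type*} [Encodable α] [Encodable A] (X : Set (α → A)) : Set (ℕ → ℕ) :=
  confFun '' X

/-- A configuration is computable if its Baire-space encoding is computable. -/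
def ComputablePoint {α A : Type*} [Encodable α] [Encodable A] (x : α → A) : Prop :=
  Computable (confFun x)

/-- `m(X) ≤ m(Y)` for sets of configurations. -/
def MedLE {α A β B : Type*} [Encodable α] [Encodable A] [Encodable β] [Encodable B]
    (X : Set (α → A)) (Y : Set (β → B)) : Prop :=
  BaireLE (mSet X) (mSet Y)

/-- `m(X) = m(Y)` for sets of configurations. -/
def MedEquiv {α A β B : Type*} [Encodable α] [Encodable A] [Encodable β] [Encodable B]
    (X : Set (α → A)) (Y : Set (β → B)) : Prop :=
  MedLE X Y ∧ MedLE Y X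

/-! ### Subshifts -/

/-- The left shift action: `(g • x) h = x (g⁻¹ h)`. -/
def shift {G A : Type*} [Group G] (g : G) (x : G → A) : G → A := fun h => x (g⁻¹ * h)

/-- The prodiscrete topology on `A^G`. -/
def prodiscrete (G A : Type*) : TopologicalSpace (G → A) :=
  @Pi.topologicalSpace G (fun _ => A) fun _ => ⊥

/-- A subshift: a shift-invariant subset of `A^G`, closed in the prodiscrete topology. -/
def IsSubshift {G A : Type*} [Group G] (X : Set (G → A)) : Prop :=
  (∀ x ∈ X, ∀ g : G, shift g x ∈ X) ∧ @IsClosed (G → A) (prodiscrete G A) X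

/-- A pattern: a map `p : D → A` with `D ⊆ G` finite. -/
structure Pattern (G A : Type*) where
  dom : Finset G
  val : {g // g ∈ dom} → A

/-- The translate `g • x` agrees with the pattern `p` on its domain. -/
def MatchesAt {G A : Type*} [Group G] (p : Pattern G A) (g : G) (x : G → A) : Prop :=
  ∀ h : {g' // g' ∈ p.dom}, shift g x h = p.val h

/-- A subshift of finite type: defined by a finite list of forbidden patterns. -/
def IsSFT {G A : Type*} [Group G] (X : Set (G → A)) : Prop :=
  ∃ F : List (Pattern G A), X = {x | ∀ p ∈ F, ∀ g : G, ¬MatchesAt p g x}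

/-- A morphism between subshifts: a continuous shift-equivariant map from `X` to `Y`. -/
def IsMorphism {G A B : Type*} [Group G] (X : Set (G → A)) (Y : Set (G → B))
    (φ : (G → A) → (G → B)) : Prop :=
  Set.MapsTo φ X Y ∧
    @ContinuousOn (G → A) (G → B) (prodiscrete G A) (prodiscrete G B) φ X ∧
    ∀ x ∈ X, ∀ g : G, φ (shift g x) = shift g (φ x)

/-- A sofic subshift: the image of an SFT (on some finite alphabet) under a topological
factor map. -/
def IsSofic {G A : Type*} [Group G] (X : Set (G → A)) : Prop :=
  ∃ (B : Type) (_ : Finite B) (Y : Set (G → B)) (φ : (G → B) → (G → A)),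
    IsSFT Y ∧ IsMorphism Y X φ ∧ φ '' Y = X

/-! ### Finitely generated groups, covers and pullbacks -/

/-- `σ` enumerates a finite symmetric generating set of `G`. -/
def IsSymmGen {G : Type*} [Group G] {k : ℕ} (σ : Fin k → G) : Prop :=
  Subgroup.closure (Set.range σ) = ⊤ ∧ ∀ i, (σ i)⁻¹ ∈ Set.range σ

/-- The canonical encoding of a free group via reduced words. -/
instance freeGroupEncodable {α : Type*} [DecidableEq α] [Encodable α] :
    Encodable (FreeGroup α) :=
  Encodable.ofLeftInjection FreeGroup.toWord (fun l => some (FreeGroup.mk l))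
    fun _ => congrArg some FreeGroup.mk_toWord

/-- The canonical homomorphism from the free group determined by `σ`. -/
def cover {G : Type*} [Group G] {k : ℕ} (σ : Fin k → G) : FreeGroup (Fin k) →* G :=
  FreeGroup.lift σ

/-- The pullback of a subshift along a group homomorphism. -/
def pullback {K G A : Type*} [Group K] [Group G] (ρ : K →* G) (X : Set (G → A)) :
    Set (K → A) :=
  (fun x => x ∘ ρ) '' X

/-- The group element represented by a word over the generators. -/
def wordVal {G : Type*} [Group G] {k : ℕ} (σ : Fin k → G) (w : List (Fin k × Bool)) : G :=
  cover σ (FreeGroup.mk w)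

/-- `G` is recursively presented w.r.t. `σ`: its word problem is recursively enumerable. -/
def RecursivelyPresented {G : Type*} [Group G] {k : ℕ} (σ : Fin k → G) : Prop :=
  ∃ f : ℕ → Option (List (Fin k × Bool)), Computable f ∧
    ∀ w : List (Fin k × Bool), (wordVal σ w = 1 ↔ ∃ n, f n = some w)

/-- The membership problem of the subgroup `H` in `G` is decidable w.r.t. `σ`. -/
def DecidableMembership {G : Type*} [Group G] {k : ℕ} (σ : Fin k → G)
    (H : Subgroup G) : Prop :=
  ∃ φ : List (Fin k × Bool) → Bool, Computable φ ∧
    ∀ w : List (Fin k × Bool), (φ w = true ↔ wordVal σ w ∈ H)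

/-- `G` has decidable word problem w.r.t. `σ`. -/
def DecidableWordProblem {G : Type*} [Group G] {k : ℕ} (σ : Fin k → G) : Prop :=
  ∃ φ : List (Fin k × Bool) → Bool, Computable φ ∧
    ∀ w : List (Fin k × Bool), (φ w = true ↔ wordVal σ w = 1)

/-- The set of configurations on the free group matching a coded pattern: a pattern is
coded as a list of pairs (code of a group element, code of a letter). -/
def codedCylinder {k : ℕ} {A : Type*} [Encodable A] (p : List (ℕ × ℕ)) :
    Set (FreeGroup (Fin k) → A) :=
  {x | ∀ q ∈ p, ∀ g : FreeGroup (Fin k),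
    Encodable.encode g = q.1 → Encodable.encode (x g) = q.2}

/-- `X` is an effective subshift: the complement of its pullback to the free group is the
union of the cylinders of a computably enumerable sequence of finitely supported patterns. -/
def IsEffective {G : Type*} [Group G] {k : ℕ} (σ : Fin k → G) {A : Type*} [Encodable A]
    (X : Set (G → A)) : Prop :=
  ∃ f : ℕ → List (ℕ × ℕ), Computable f ∧
    (pullback (cover σ) X)ᶜ = ⋃ n, codedCylinder (f n)

/-! ### Degree spectra -/

/-- The Medvedev degree of `P` belongs to `M_SFT(G)`: some nonempty `G`-SFT has the
Medvedev degree of `P`. -/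
def IsSFTDeg {G : Type*} [Group G] {k : ℕ} (σ : Fin k → G) (P : Set (ℕ → ℕ)) : Prop :=
  ∃ (n : ℕ) (X : Set (G → Fin n)), IsSFT X ∧ X.Nonempty ∧
    BaireEquiv (mSet (pullback (cover σ) X)) P

/-- The Medvedev degree of `P` belongs to `M_sof(G)`. -/
def IsSoficDeg {G : Type*} [Group G] {k : ℕ} (σ : Fin k → G) (P : Set (ℕ → ℕ)) : Prop :=
  ∃ (n : ℕ) (X : Set (G → Fin n)), IsSofic X ∧ X.Nonempty ∧
    BaireEquiv (mSet (pullback (cover σ) X)) P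

/-- The Medvedev degree of `P` belongs to `M_eff(G)`. -/
def IsEffDeg {G : Type*} [Group G] {k : ℕ} (σ : Fin k → G) (P : Set (ℕ → ℕ)) : Prop :=
  ∃ (n : ℕ) (X : Set (G → Fin n)), IsSubshift X ∧ IsEffective σ X ∧ X.Nonempty ∧
    BaireEquiv (mSet (pullback (cover σ) X)) P

/-! ### Word metrics and quasi-isometries -/

/-- The word length of `g` w.r.t. the (symmetric) generating map `σ`. -/
noncomputable def wordNorm {G : Type*} [Group G] {k : ℕ} (σ : Fin k → G) (g : G) : ℕ :=
  sInf {n | ∃ w : List (Fin k), w.length = n ∧ (w.map σ).prod = g}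

/-- The word metric on `G` w.r.t. `σ`, as a real number. -/
noncomputable def wordDist {G : Type*} [Group G] {k : ℕ} (σ : Fin k → G) (g g' : G) : ℝ :=
  (wordNorm σ (g⁻¹ * g') : ℝ)

/-- `f : G → H` is a quasi-isometry w.r.t. the word metrics given by `σ` and `τ`. -/
def IsQIGroups {G H : Type*} [Group G] [Group H] {k r : ℕ} (σ : Fin k → G)
    (τ : Fin r → H) (f : G → H) : Prop :=
  ∃ C : ℝ, 1 ≤ C ∧
    (∀ g g' : G, (1 / C) * wordDist σ g g' - C ≤ wordDist τ (f g) (f g') ∧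
      wordDist τ (f g) (f g') ≤ C * wordDist σ g g' + C) ∧
    ∀ h : H, ∃ g : G, wordDist τ h (f g) ≤ C

/-- `f : G → Y` is a quasi-isometry from the group `G` (with word metric from `σ`) to the
metric space `Y`. -/
def IsQIToSpace {G : Type*} [Group G] {k : ℕ} (σ : Fin k → G) {Y : Type*}
    [MetricSpace Y] (f : G → Y) : Prop :=
  ∃ C : ℝ, 1 ≤ C ∧
    (∀ g g' : G, (1 / C) * wordDist σ g g' - C ≤ dist (f g) (f g') ∧
      dist (f g) (f g') ≤ C * wordDist σ g g' + C) ∧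
    ∀ y : Y, ∃ g : G, dist y (f g) ≤ C

/-- `f : G → H` is computable w.r.t. the generating maps `σ` and `τ`: some computable map
on words sends each word representing `g` to a word representing `f g`. -/
def ComputableMap {G H : Type*} [Group G] [Group H] {k r : ℕ} (σ : Fin k → G)
    (τ : Fin r → H) (f : G → H) : Prop :=
  ∃ φ : List (Fin k × Bool) → List (Fin r × Bool), Computable φ ∧
    ∀ w : List (Fin k × Bool), wordVal τ (φ w) = f (wordVal σ w)

/-! ### Generic criteria via primitive recursive tests and readouts -/

theorem length_pref (x : ℕ → ℕ) (n : ℕ) : (pref x n).length = n := by simp [pref]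

theorem getElem_pref (x : ℕ → ℕ) {n i : ℕ} (h : i < (pref x n).length) : (pref x n)[i] = x i := by
  simp [pref]

theorem getD_pref (x : ℕ → ℕ) {n i : ℕ} (h : i < n) : (pref x n).getD i 0 = x i := by
  simp [pref, h]

theorem take_pref (x : ℕ → ℕ) {m n : ℕ} (h : m ≤ n) : (pref x n).take m = pref x m := by
  simp [pref, ← List.map_take, List.take_range, h]

theorem pref_prefix (x : ℕ → ℕ) {m n : ℕ} (h : m ≤ n) : pref x m <+: pref x n := by
  rw [← take_pref x h]; exact List.take_prefix _ _

theorem mem_cylinder_iff {l : List ℕ} {x : ℕ → ℕ} : x ∈ cylinder l ↔ pref x l.length = l := by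
  constructor
  · intro h
    refine List.ext_getElem (length_pref _ _) fun i _ h₂ => ?_
    rw [getElem_pref]; exact h i h₂
  · intro h i hi
    rw [← getD_pref x hi, h, List.getD_eq_getElem _ _ hi]

theorem getElem?_of_prefix {l₁ l₂ : List ℕ} (h : l₁ <+: l₂) {i a : ℕ} (hi : l₁[i]? = some a) :
    l₂[i]? = some a := by
  obtain ⟨t, rfl⟩ := h
  obtain ⟨hlt, -⟩ := List.getElem?_eq_some_iff.1 hi
  rwa [List.getElem?_append_left hlt]

/-- A functional given by a primitive recursive readout with primitive recursive use. -/
theorem BaireLE.of_use {P Q : Set (ℕ → ℕ)} {u : ℕ → ℕ} {g : ℕ → List ℕ → ℕ} (hu : Primrec u)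
    (hg : Primrec₂ g) (h : ∀ x ∈ Q, (fun n => g n (pref x (u n))) ∈ P) : BaireLE P Q := by
  let N : ℕ → ℕ := fun L => Nat.findGreatest (fun N => ∀ n < N, u n ≤ L) L
  have hN : Primrec N := by
    refine Primrec.nat_findGreatest Primrec.id ?_
    have h₁ : PrimrecRel fun n L : ℕ => u n ≤ L :=
      Primrec.nat_le.comp (hu.comp Primrec.fst) Primrec.snd
    exact h₁.forall_lt.comp Primrec.snd Primrec.fst
  have hspec : ∀ L, ∀ n < N L, u n ≤ L := fun L =>
    Nat.findGreatest_spec (P := fun N => ∀ n < N, u n ≤ L) (Nat.zero_le L) (by simp)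
  have hmono : ∀ L L', L ≤ L' → N L ≤ N L' := fun L L' hL =>
    Nat.le_findGreatest ((Nat.findGreatest_le _).trans hL) fun n hn => (hspec L n hn).trans hL
  refine ⟨fun l => (List.range (N l.length)).map fun n => g n (l.take (u n)), ?_, ?_, ?_⟩
  · refine Primrec.to_comp (Primrec.list_map
      (Primrec.list_range.comp (hN.comp Primrec.list_length)) ?_)
    exact hg.comp Primrec.snd
      (Primrec.list_take.comp (hu.comp Primrec.snd) Primrec.fst)
  · intro l₁ l₂ hl
    have hle := hmono _ _ hl.length_le
    have : (List.range (N l₁.length)).map (fun n => g n (l₁.take (u n))) =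
        ((List.range (N l₂.length)).map fun n => g n (l₂.take (u n))).take (N l₁.length) := by
      rw [← List.map_take, List.take_range, min_eq_left hle]
      refine List.map_congr_left fun n hn => ?_
      have := hspec _ n (List.mem_range.1 hn)
      obtain ⟨t, rfl⟩ := hl
      rw [List.take_append_of_le_length this]
    show List.map _ _ <+: List.map _ _
    rw [this]; exact List.take_prefix _ _
  · intro x hx
    refine ⟨_, h x hx, fun n => ?_⟩
    obtain ⟨K, hK, hnK⟩ : ∃ K, (∀ m < n + 1, u m ≤ K) ∧ n + 1 ≤ K := by
      refine ⟨(∑ m ∈ Finset.range (n + 1), u m) + (n + 1), fun m hm => ?_, by omega⟩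
      have := Finset.single_le_sum (f := u) (fun _ _ => Nat.zero_le _) (Finset.mem_range.2 hm)
      omega
    have hn : n < N K := Nat.le_findGreatest hnK hK
    refine ⟨K, ?_⟩
    simp only [length_pref, List.getElem?_map, List.getElem?_range hn, Option.map_some]
    rw [take_pref x (hspec K n hn)]

theorem BaireLE.trans {P Q R : Set (ℕ → ℕ)} (h₁ : BaireLE P Q) (h₂ : BaireLE Q R) :
    BaireLE P R := by
  obtain ⟨φ, hφ, mφ, hφ'⟩ := h₁
  obtain ⟨ψ, hψ, mψ, hψ'⟩ := h₂
  refine ⟨fun l => φ (ψ l), hφ.comp hψ, fun l₁ l₂ h => mφ _ _ (mψ _ _ h), fun x hx => ?_⟩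
  obtain ⟨y, hy, hxy⟩ := hψ' x hx
  obtain ⟨z, hz, hyz⟩ := hφ' y hy
  have key : ∀ j, ∃ k, pref y j <+: ψ (pref x k) := by
    intro j
    choose κ hκ using hxy
    let K := ∑ i ∈ Finset.range j, κ i
    have hK : ∀ i < j, (ψ (pref x K))[i]? = some (y i) := fun i hi =>
      getElem?_of_prefix
        (mψ _ _ (pref_prefix x (Finset.single_le_sum (f := κ) (fun _ _ => Nat.zero_le _)
          (Finset.mem_range.2 hi)))) (hκ i)
    refine ⟨K, List.prefix_iff_getElem?.2 fun i hi => ?_⟩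
    rw [getElem_pref]; exact hK i (by simpa [length_pref] using hi)
  refine ⟨z, hz, fun n => ?_⟩
  obtain ⟨j, hj⟩ := hyz n
  obtain ⟨k, hk⟩ := key j
  refine ⟨k, getElem?_of_prefix (mφ _ _ hk) hj⟩

theorem isPi01Cantor_of_test {ι : Type*} [Primcodable ι] {P : Set (ℕ → ℕ)} {u : ι → ℕ}
    {T : ι → List ℕ → Prop} (hu : Primrec u) (hT : PrimrecRel T) (hP : P ⊆ cantorSpace)
    (h : ∀ x ∈ cantorSpace, (x ∈ P ↔ ∀ j, T j (pref x (u j)))) : IsPi01Cantor P := by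
  classical
  have hbad : PrimrecPred fun p : ι × List ℕ => p.2.length = u p.1 ∧ ¬ T p.1 p.2 :=
    (Primrec.eq.comp (Primrec.list_length.comp Primrec.snd) (hu.comp Primrec.fst)).and hT.not
  let F : ι × List ℕ → List ℕ := fun p => if p.2.length = u p.1 ∧ ¬ T p.1 p.2 then p.2 else [2]
  have hF : Primrec F := Primrec.ite hbad Primrec.snd (Primrec.const _)
  refine ⟨fun m => ((Encodable.decode m).map F).getD [2], ?_, ?_⟩
  · exact (Primrec.option_getD.comp (Primrec.option_map Primrec.decode (hF.comp Primrec.snd).to₂)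
      (Primrec.const _)).to_comp
  · ext x
    rw [Set.mem_sdiff]
    have h2 : x ∈ cantorSpace → x ∉ cylinder [2] := fun hx hc => by
      have := hc 0 (by simp); have := hx 0; simp_all
    constructor
    · intro hx
      refine ⟨hP hx, fun hx' => ?_⟩
      obtain ⟨m, hm⟩ := Set.mem_iUnion.1 hx'
      rcases hd : (Encodable.decode m : Option (ι × List ℕ)) with _ | p
      · simp only [hd, Option.map_none, Option.getD_none] at hm
        exact h2 (hP hx) hm
      · simp only [hd, Option.map_some, Option.getD_some, F] at hm
        split_ifs at hm with hc
        · rw [mem_cylinder_iff, hc.1] at hm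
          apply hc.2
          rw [← hm]
          exact (h x (hP hx)).1 hx _
        · exact h2 (hP hx) hm
    · rintro ⟨hx, hx'⟩
      rw [h x hx]
      by_contra! hcon
      obtain ⟨j, hj⟩ := hcon
      refine hx' (Set.mem_iUnion.2 ⟨Encodable.encode (j, pref x (u j)), ?_⟩)
      simp only [Encodable.encodek, Option.map_some, Option.getD_some, F]
      rw [if_pos ⟨length_pref _ _, hj⟩, mem_cylinder_iff, length_pref]

/-! ### A universal constraint on `{0,1}`-valued sequences -/

/-- The words enumerated by the `e`-th code within `s` steps. -/
def enumWords (e s : ℕ) : List (List ℕ) :=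
  (List.range s).filterMap fun i =>
    (Nat.Partrec.Code.evaln s (Denumerable.ofNat Nat.Partrec.Code e) i).bind Encodable.decode

/-- No word enumerated by the `e`-th code within `s` steps is a prefix of `v`. -/
def Avoids (e s : ℕ) (v : List ℕ) : Prop := ∀ w ∈ enumWords e s, v.take w.length ≠ w

/-- The first `s` binary digits of `c`, least significant first. -/
def bits (s c : ℕ) : List ℕ := (List.range s).map fun i => c / 2 ^ i % 2

/-- If some binary word of length `s` avoids the words enumerated by `e` within `s` steps,
then `v` does. -/
def Admissible (e s : ℕ) (v : List ℕ) : Prop := (∃ c < 2 ^ s, Avoids e s (bits s c)) → Avoids e s v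

theorem primrec_enumWords : Primrec fun p : ℕ × ℕ => enumWords p.1 p.2 := by
  refine Primrec.listFilterMap (Primrec.list_range.comp Primrec.snd) ?_
  refine Primrec.option_bind ?_ (Primrec.decode.comp Primrec.snd).to₂
  exact Nat.Partrec.Code.primrec_evaln.comp
    (((Primrec.snd.comp Primrec.fst).pair
      ((Primrec.ofNat _).comp (Primrec.fst.comp Primrec.fst))).pair Primrec.snd)

theorem primrec_avoids : PrimrecPred fun p : (ℕ × ℕ) × List ℕ => Avoids p.1.1 p.1.2 p.2 := by
  have h : PrimrecRel fun w v : List ℕ => v.take w.length ≠ w :=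
    PrimrecPred.not (Primrec.eq.comp
      (Primrec.list_take.comp (Primrec.list_length.comp Primrec.fst) Primrec.snd) Primrec.fst)
  exact h.forall_mem_list.comp (primrec_enumWords.comp Primrec.fst) Primrec.snd

theorem primrec_pow : Primrec₂ fun a b : ℕ => a ^ b := by
  have : Primrec₂ fun a b : ℕ => Nat.rec (motive := fun _ => ℕ) 1 (fun _ r => r * a) b :=
    Primrec.nat_rec (Primrec.const 1)
      (Primrec.nat_mul.comp (Primrec.snd.comp Primrec.snd) Primrec.fst).to₂
  refine this.of_eq fun a b => ?_
  induction b with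
  | zero => simp
  | succ b ih => simp [pow_succ, ih]

theorem primrec_bits : Primrec₂ bits := by
  refine Primrec.list_map (Primrec.list_range.comp Primrec.fst) ?_
  exact Primrec.nat_mod.comp (Primrec.nat_div.comp (Primrec.snd.comp Primrec.fst)
    (primrec_pow.comp (Primrec.const 2) Primrec.snd)) (Primrec.const 2)

theorem primrec_admissible :
    PrimrecPred fun p : (ℕ × ℕ) × List ℕ => Admissible p.1.1 p.1.2 p.2 := by
  have h : PrimrecRel fun (c : ℕ) (p : ℕ × ℕ) => Avoids p.1 p.2 (bits p.2 c) :=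
    primrec_avoids.comp (Primrec.snd.pair
      (primrec_bits.comp (Primrec.snd.comp Primrec.snd) Primrec.fst))
  have h' := h.exists_mem_list
  have h₁ : PrimrecPred fun p : (ℕ × ℕ) × List ℕ =>
      ∃ c < 2 ^ p.1.2, Avoids p.1.1 p.1.2 (bits p.1.2 c) :=
    (PrimrecRel.comp h' (Primrec.list_range.comp (primrec_pow.comp (Primrec.const 2)
      (Primrec.snd.comp Primrec.fst))) Primrec.fst).of_eq fun p => by simp
  exact (h₁.not.or primrec_avoids).of_eq fun p => by simp only [Admissible, imp_iff_not_or]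

theorem exists_bits_eq (s : ℕ) (x : ℕ → ℕ) (hx : ∀ n, x n ≤ 1) :
    ∃ c < 2 ^ s, bits s c = pref x s := by
  induction s generalizing x with
  | zero => exact ⟨0, by simp, by simp [bits, pref]⟩
  | succ s ih =>
    obtain ⟨c, hc, h⟩ := ih (fun n => x (n + 1)) fun n => hx _
    have h0 := hx 0
    refine ⟨x 0 + 2 * c, by rw [pow_succ]; omega, ?_⟩
    have h' := List.map_inj_left.1 h
    simp only [bits, pref, List.map_inj_left, List.mem_range] at h' ⊢
    rintro (_ | i) hi
    · simp; omega
    · rw [← h' i (by omega), pow_succ', ← Nat.div_div_eq_div_mul]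
      congr 2; omega

theorem bits_eq_pref (s c : ℕ) : bits s c = pref (fun i => c / 2 ^ i % 2) s := rfl

theorem Avoids.mono {e s t : ℕ} (hst : s ≤ t) {x : ℕ → ℕ} (h : Avoids e t (pref x t)) :
    Avoids e s (pref x s) := by
  intro w hw hx
  have hlen : w.length ≤ s := by
    rw [← hx]; simp [length_pref]
  refine h w ?_ ?_
  · simp only [enumWords, List.mem_filterMap, List.mem_range, Option.bind_eq_some_iff] at hw ⊢
    obtain ⟨i, hi, m, hm, hd⟩ := hw
    exact ⟨i, hi.trans_le hst, m, Nat.Partrec.Code.evaln_mono hst hm, hd⟩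
  · rw [take_pref x hlen] at hx
    rw [take_pref x (hlen.trans hst), hx]

theorem pref_congr {x y : ℕ → ℕ} {s : ℕ} (h : ∀ i < s, x i = y i) : pref x s = pref y s :=
  List.map_congr_left fun i hi => h i (List.mem_range.1 hi)

theorem exists_admissible (e : ℕ) :
    ∃ x : ℕ → ℕ, (∀ n, x n ≤ 1) ∧ ∀ s, Admissible e s (pref x s) := by
  have key : ∀ t, ∃ x : ℕ → ℕ, (∀ n, x n ≤ 1) ∧ ∀ s ≤ t, Admissible e s (pref x s) := by
    intro t
    induction t with
    | zero =>
      refine ⟨fun _ => 0, by simp, fun s hs _ => ?_⟩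
      obtain rfl : s = 0 := by omega
      simp [Avoids, enumWords]
    | succ t ih =>
      by_cases h : ∃ c < 2 ^ (t + 1), Avoids e (t + 1) (bits (t + 1) c)
      · obtain ⟨c, -, hc⟩ := h
        rw [bits_eq_pref] at hc
        exact ⟨_, fun n => Nat.le_of_lt_succ (Nat.mod_lt _ two_pos), fun s hs _ => hc.mono hs⟩
      · obtain ⟨x, hx, hxs⟩ := ih
        refine ⟨x, hx, fun s hs => ?_⟩
        rcases Nat.lt_or_ge t s with hlt | hle
        · obtain rfl : s = t + 1 := by omega
          exact fun h' => absurd h' h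
        · exact hxs s hle
  choose X hX hXs using key
  let 𝓤 := Filter.hyperfilter ℕ
  classical
  have hlim : ∀ i, ∃ v ≤ 1, ∀ᶠ t in (𝓤 : Filter ℕ), X t i = v := by
    intro i
    have : ∀ᶠ t in (𝓤 : Filter ℕ), X t i = 0 ∨ X t i = 1 :=
      Filter.Eventually.of_forall fun t => by have := hX t i; omega
    rcases Ultrafilter.eventually_or.1 this with h | h
    · exact ⟨0, by omega, h⟩
    · exact ⟨1, le_rfl, h⟩
  choose x hx hlim using hlim
  refine ⟨x, hx, fun s => ?_⟩
  have h₁ : ∀ᶠ t in (𝓤 : Filter ℕ), ∀ i ∈ Finset.range s, X t i = x i :=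
    (Filter.eventually_all_finset _).2 fun i _ => hlim i
  have h₂ : ∀ᶠ t in (𝓤 : Filter ℕ), s ≤ t :=
    Nat.hyperfilter_le_atTop (Filter.eventually_ge_atTop s)
  obtain ⟨t, ht₁, ht₂⟩ := (h₁.and h₂).exists
  rw [← pref_congr fun i hi => ht₁ i (Finset.mem_range.2 hi)]
  exact hXs t s ht₂

/-- Every coded section of the sequence `y` satisfies the universal constraint. -/
def Universal (y : ℕ → ℕ) : Prop :=
  ∀ e s, Admissible e s (pref (fun n => y (Nat.pair e n)) s)

theorem exists_universal : ∃ y : ℕ → ℕ, (∀ n, y n ≤ 1) ∧ Universal y := by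
  choose x hx h using exists_admissible
  refine ⟨fun m => x m.unpair.1 m.unpair.2, fun n => hx _ _, fun e s => ?_⟩
  simpa using h e s

theorem exists_section_mem {Q : Set (ℕ → ℕ)} (hQ : IsPi01Cantor Q) (hne : Q.Nonempty) :
    ∃ e, ∀ y : ℕ → ℕ, (∀ n, y n ≤ 1) → Universal y → (fun n => y (Nat.pair e n)) ∈ Q := by
  obtain ⟨f, hf, rfl⟩ := hQ
  obtain ⟨x, hx, hx'⟩ := hne
  have hf' : Nat.Partrec ((fun n => Encodable.encode (f n) : ℕ → ℕ) : ℕ →. ℕ) :=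
    Partrec.nat_iff.1 (Computable.encode.comp hf)
  obtain ⟨c, hc⟩ := Nat.Partrec.Code.exists_code.1 hf'
  have hofNat : Denumerable.ofNat Nat.Partrec.Code (Encodable.encode c) = c :=
    Denumerable.ofNat_encode c
  have hev : ∀ {s i m}, m ∈ Nat.Partrec.Code.evaln s c i → m = Encodable.encode (f i) := by
    intro s i m hm
    have := Nat.Partrec.Code.evaln_sound hm
    rw [hc] at this
    exact Part.mem_some_iff.1 this
  refine ⟨Encodable.encode c, fun y hy hU => ⟨fun n => hy _, fun hmem => ?_⟩⟩
  obtain ⟨i, hi⟩ := Set.mem_iUnion.1 hmem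
  rw [mem_cylinder_iff] at hi
  obtain ⟨s₀, hs₀⟩ : ∃ s, Encodable.encode (f i) ∈ Nat.Partrec.Code.evaln s c i := by
    rw [← Nat.Partrec.Code.evaln_complete, hc]; exact Part.mem_some _
  let s := max s₀ (max (i + 1) (f i).length)
  have hs : Encodable.encode (f i) ∈ Nat.Partrec.Code.evaln s c i :=
    Nat.Partrec.Code.evaln_mono (le_max_left _ _) hs₀
  have his : i < s := lt_of_lt_of_le (Nat.lt_succ_self i)
    ((le_max_left _ _).trans (le_max_right _ _))
  have hls : (f i).length ≤ s := (le_max_right _ _).trans (le_max_right _ _)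
  have hav : ∃ c' < 2 ^ s, Avoids (Encodable.encode c) s (bits s c') := by
    obtain ⟨c', hc', hb⟩ := exists_bits_eq s x hx
    refine ⟨c', hc', ?_⟩
    rw [hb]
    intro w hw hw'
    simp only [enumWords, List.mem_filterMap, Option.bind_eq_some_iff, hofNat] at hw
    obtain ⟨j, -, m, hm, hd⟩ := hw
    rw [hev hm, Encodable.encodek, Option.some.injEq] at hd
    subst hd
    have hl : (f j).length ≤ s := by rw [← hw']; simp [length_pref]
    rw [take_pref x hl] at hw'
    exact hx' (Set.mem_iUnion.2 ⟨j, mem_cylinder_iff.2 hw'⟩)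
  refine hU (Encodable.encode c) s hav (f i) ?_ ?_
  · simp only [enumWords, List.mem_filterMap, Option.bind_eq_some_iff, hofNat]
    exact ⟨i, List.mem_range.2 his, _, hs, Encodable.encodek _⟩
  · rw [take_pref _ hls, hi]

/-! ### Following pointers -/

/-- The pointer stored in a letter. -/
def pointer (k : ℕ) [NeZero k] (a : ℕ) : Fin k := (Encodable.decode (a / 2)).getD 0

theorem pointer_two_mul_add {k : ℕ} [NeZero k] (i : Fin k) {b : ℕ} (hb : b ≤ 1) :
    pointer k (2 * i + b) = i := by
  have h : (2 * (i : ℕ) + b) / 2 = Encodable.encode i := by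
    show _ = (i : ℕ); omega
  rw [pointer, h, Encodable.encodek]; rfl

/-- Follow `i` pointers from the word `w`, where `z` assigns to the code of a word the successor
of the letter at that word. Returns the endpoint and the number of odd letters seen. -/
def scan {k : ℕ} [NeZero k] (z : ℕ → ℕ) (w : List (Fin k × Bool)) (i : ℕ) :
    List (Fin k × Bool) × ℕ :=
  Nat.rec (w, 0) (fun _ p => (p.1 ++ [(pointer k (z (Encodable.encode p.1) - 1), true)],
    p.2 + (z (Encodable.encode p.1) - 1) % 2)) i

/-- The `n`-th binary digit read along the pointers from the word `w`. -/
def digit {k : ℕ} [NeZero k] (z : ℕ → ℕ) (w : List (Fin k × Bool)) (n : ℕ) : ℕ :=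
  (scan z w (4 ^ (n + 1))).2 / 2 % 2

theorem scan_succ {k : ℕ} [NeZero k] (z : ℕ → ℕ) (w : List (Fin k × Bool)) (i : ℕ) :
    scan z w (i + 1) =
      ((scan z w i).1 ++ [(pointer k (z (Encodable.encode (scan z w i).1) - 1), true)],
        (scan z w i).2 + (z (Encodable.encode (scan z w i).1) - 1) % 2) := rfl

theorem length_scan {k : ℕ} [NeZero k] (z : ℕ → ℕ) (w : List (Fin k × Bool)) (i : ℕ) :
    (scan z w i).1.length = w.length + i := by
  induction i with
  | zero => rfl
  | succ i ih =>
    simp only [scan_succ, List.length_append, ih, List.length_singleton]; omega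

theorem scan_congr {k : ℕ} [NeZero k] {z z' : ℕ → ℕ} {w : List (Fin k × Bool)} {i : ℕ}
    (h : ∀ v : List (Fin k × Bool), v.length < w.length + i →
      z (Encodable.encode v) = z' (Encodable.encode v)) : scan z w i = scan z' w i := by
  induction i with
  | zero => rfl
  | succ i ih =>
    have ih := ih fun v hv => h v (by omega)
    have hz := h (scan z' w i).1 (by rw [length_scan]; omega)
    rw [scan_succ, scan_succ, ih, hz]

theorem digit_congr {k : ℕ} [NeZero k] {z z' : ℕ → ℕ} {w : List (Fin k × Bool)} {n : ℕ}
    (h : ∀ v : List (Fin k × Bool), v.length < w.length + 4 ^ (n + 1) →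
      z (Encodable.encode v) = z' (Encodable.encode v)) : digit z w n = digit z' w n := by
  rw [digit, digit, scan_congr h]

theorem digit_le_one {k : ℕ} [NeZero k] (z : ℕ → ℕ) (w : List (Fin k × Bool)) (n : ℕ) :
    digit z w n ≤ 1 := Nat.le_of_lt_succ (Nat.mod_lt _ two_pos)

theorem primrec_digit {k : ℕ} [NeZero k] :
    Primrec fun p : (List ℕ × List (Fin k × Bool)) × ℕ =>
      digit (fun c => p.1.1.getD c 0) p.1.2 p.2 := by
  let W := List (Fin k × Bool)
  have hletter : Primrec fun q : ((List ℕ × W) × ℕ) × (ℕ × (W × ℕ)) =>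
      q.1.1.1.getD (Encodable.encode q.2.2.1) 0 - 1 :=
    Primrec.nat_sub.comp ((Primrec.list_getD 0).comp
      (Primrec.fst.comp (Primrec.fst.comp Primrec.fst))
      (Primrec.encode.comp (Primrec.fst.comp (Primrec.snd.comp Primrec.snd)))) (Primrec.const 1)
  have hptr : Primrec (pointer k) :=
    Primrec.option_getD.comp (Primrec.decode.comp
      (Primrec.nat_div.comp Primrec.id (Primrec.const 2))) (Primrec.const 0)
  have hstep : Primrec₂ fun (p : (List ℕ × W) × ℕ) (q : ℕ × (W × ℕ)) =>
      ((q.2.1 ++ [(pointer k (p.1.1.getD (Encodable.encode q.2.1) 0 - 1), true)],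
        q.2.2 + (p.1.1.getD (Encodable.encode q.2.1) 0 - 1) % 2) : W × ℕ) := by
    refine Primrec.pair (Primrec.list_concat.comp
      (Primrec.fst.comp (Primrec.snd.comp Primrec.snd))
      ((hptr.comp hletter).pair (Primrec.const true))) ?_
    exact Primrec.nat_add.comp (Primrec.snd.comp (Primrec.snd.comp Primrec.snd))
      (Primrec.nat_mod.comp hletter (Primrec.const 2))
  have hscan : Primrec fun p : (List ℕ × W) × ℕ =>
      scan (fun c => p.1.1.getD c 0) p.1.2 (4 ^ (p.2 + 1)) :=
    Primrec.nat_rec' (primrec_pow.comp (Primrec.const 4) (Primrec.succ.comp Primrec.snd))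
      ((Primrec.snd.comp Primrec.fst).pair (Primrec.const 0)) hstep
  exact Primrec.nat_mod.comp (Primrec.nat_div.comp (Primrec.snd.comp hscan) (Primrec.const 2))
    (Primrec.const 2)

/-- A bound for the codes of the words of length at most `L`. -/
def codeBound (k L : ℕ) : ℕ :=
  Nat.rec 0 (fun _ b => Nat.pair (Nat.pair k 1) b + 1) L

theorem primrec_codeBound (k : ℕ) : Primrec (codeBound k) :=
  Primrec.nat_rec₁ 0 (Primrec.succ.comp
    (Primrec₂.natPair.comp (Primrec.const _) Primrec.snd)).to₂

theorem encode_le_codeBound {k : ℕ} {w : List (Fin k × Bool)} {L : ℕ} (h : w.length ≤ L) :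
    Encodable.encode w ≤ codeBound k L := by
  induction L generalizing w with
  | zero =>
    obtain rfl : w = [] := List.length_eq_zero_iff.1 (by omega)
    exact le_rfl
  | succ L ih =>
    rcases w with _ | ⟨⟨i, b⟩, w⟩
    · exact Nat.zero_le _
    · rw [Encodable.encode_list_cons]
      have hw : Encodable.encode w ≤ codeBound k L := ih (by simpa using h)
      have hi : Encodable.encode i ≤ k := i.2.le
      have hb : Encodable.encode b ≤ 1 := by cases b <;> decide
      refine Nat.succ_le_succ ?_
      calc Nat.pair (Encodable.encode (i, b)) (Encodable.encode w)
          ≤ Nat.pair (Nat.pair k 1) (Encodable.encode w) :=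
            (StrictMono.monotone fun _ _ h => Nat.pair_lt_pair_left _ h) <| by
              rw [Encodable.encode_prod_val]
              exact ((StrictMono.monotone fun _ _ h => Nat.pair_lt_pair_left _ h) hi).trans
                ((StrictMono.monotone fun _ _ h => Nat.pair_lt_pair_right _ h) hb)
        _ ≤ _ := (StrictMono.monotone fun _ _ h => Nat.pair_lt_pair_right _ h) hw

theorem wordVal_append {G : Type*} [Group G] {k : ℕ} (σ : Fin k → G)
    (v w : List (Fin k × Bool)) :
    wordVal σ (v ++ w) = wordVal σ v * wordVal σ w := by
  rw [wordVal, ← FreeGroup.mul_mk, map_mul]; rfl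

theorem wordVal_nil {G : Type*} [Group G] {k : ℕ} (σ : Fin k → G) : wordVal σ [] = 1 :=
  map_one (cover σ)

theorem wordVal_singleton {G : Type*} [Group G] {k : ℕ} (σ : Fin k → G) (i : Fin k) :
    wordVal σ [(i, true)] = σ i := by
  simp [wordVal, cover]

section Walk

variable {G : Type*} [Group G] {k : ℕ} [NeZero k]

/-- Follow `i` pointers in the configuration `x` from `g`, counting the odd letters seen. -/
def walk (σ : Fin k → G) (x : G → Fin (2 * k)) (g : G) (i : ℕ) : G × ℕ :=
  Nat.rec (g, 0) (fun _ p => (p.1 * σ (pointer k (x p.1)), p.2 + x p.1 % 2)) i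

/-- The `n`-th binary digit read along the pointers of `x` from `g`. -/
def walkDigit (σ : Fin k → G) (x : G → Fin (2 * k)) (g : G) (n : ℕ) : ℕ :=
  (walk σ x g (4 ^ (n + 1))).2 / 2 % 2

/-- The configurations for which the digits read from every group element satisfy the
universal constraint. -/
def universalSubshift (σ : Fin k → G) : Set (G → Fin (2 * k)) :=
  {x | ∀ g, Universal (walkDigit σ x g)}

theorem walk_succ (σ : Fin k → G) (x : G → Fin (2 * k)) (g : G) (i : ℕ) :
    walk σ x g (i + 1) = ((walk σ x g i).1 * σ (pointer k (x (walk σ x g i).1)),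
      (walk σ x g i).2 + x (walk σ x g i).1 % 2) := rfl

theorem walk_eq_scan {σ : Fin k → G} {x : G → Fin (2 * k)} {z : ℕ → ℕ}
    (h : ∀ w : List (Fin k × Bool), z (Encodable.encode w) = x (wordVal σ w) + 1)
    (w : List (Fin k × Bool)) (i : ℕ) :
    walk σ x (wordVal σ w) i = (wordVal σ (scan z w i).1, (scan z w i).2) := by
  induction i with
  | zero => rfl
  | succ i ih =>
    have hz := h (scan z w i).1
    rw [walk_succ, scan_succ, ih, wordVal_append, wordVal_singleton, hz]; simp

theorem walkDigit_eq_digit {σ : Fin k → G} {x : G → Fin (2 * k)} {z : ℕ → ℕ}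
    (h : ∀ w : List (Fin k × Bool), z (Encodable.encode w) = x (wordVal σ w) + 1)
    (w : List (Fin k × Bool)) : walkDigit σ x (wordVal σ w) = digit z w := by
  ext n; rw [walkDigit, walk_eq_scan h, digit]

theorem walk_shift (σ : Fin k → G) (x : G → Fin (2 * k)) (h g : G) (i : ℕ) :
    walk σ (shift h x) g i = (h * (walk σ x (h⁻¹ * g) i).1, (walk σ x (h⁻¹ * g) i).2) := by
  induction i with
  | zero => simp [walk]
  | succ i ih =>
    rw [walk_succ, walk_succ, ih]; simp [shift, mul_assoc]

theorem continuous_walk [TopologicalSpace G] [DiscreteTopology G]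
    [TopologicalSpace (Fin (2 * k))] [DiscreteTopology (Fin (2 * k))]
    (σ : Fin k → G) (g : G) (i : ℕ) : Continuous fun x : G → Fin (2 * k) => walk σ x g i := by
  induction i with
  | zero => exact continuous_const
  | succ i ih =>
    have hread : Continuous fun x : G → Fin (2 * k) => x (walk σ x g i).1 := by
      refine continuous_iff_continuousAt.2 fun x₀ => ?_
      have h₁ : ∀ᶠ x in nhds x₀, walk σ x g i = walk σ x₀ g i := by
        have := ih.continuousAt (x := x₀)
        rwa [ContinuousAt, nhds_discrete (G × ℕ), Filter.tendsto_pure] at this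
      exact (continuous_apply (walk σ x₀ g i).1).continuousAt.congr
        (h₁.mono fun x hx => by simp only [hx])
    have hstep : Continuous fun q : (G × ℕ) × Fin (2 * k) =>
        (q.1.1 * σ (pointer k q.2), q.1.2 + (q.2 : ℕ) % 2) := continuous_of_discreteTopology
    exact hstep.comp (ih.prodMk hread)

theorem isSubshift_universalSubshift (σ : Fin k → G) : IsSubshift (universalSubshift σ) := by
  constructor
  · intro x hx h g
    convert hx (h⁻¹ * g) using 1
    ext n; simp only [walkDigit, walk_shift]
  · let : TopologicalSpace G := ⊥
    have : DiscreteTopology G := ⟨rfl⟩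
    let : TopologicalSpace (Fin (2 * k)) := ⊥
    have : DiscreteTopology (Fin (2 * k)) := ⟨rfl⟩
    show IsClosed (universalSubshift σ)
    have : universalSubshift σ = ⋂ g, ⋂ e, ⋂ s, {x | Admissible e s
        (pref (fun n => walkDigit σ x g (Nat.pair e n)) s)} := by
      ext x; simp [universalSubshift, Universal]
    rw [this]
    refine isClosed_iInter fun g => isClosed_iInter fun e => isClosed_iInter fun s => ?_
    let : TopologicalSpace (List ℕ) := ⊥
    have : DiscreteTopology (List ℕ) := ⟨rfl⟩
    have hd : ∀ n, Continuous fun x => walkDigit σ x g n := fun n =>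
      (continuous_of_discreteTopology (f := fun q : G × ℕ => q.2 / 2 % 2)).comp
        (continuous_walk σ g _)
    have hc : Continuous fun x => pref (fun n => walkDigit σ x g (Nat.pair e n)) s := by
      induction s with
      | zero => exact continuous_const
      | succ s ih =>
        simp only [pref, List.range_succ, List.map_append] at ih ⊢
        exact (continuous_of_discreteTopology (f := fun q : List ℕ × ℕ => q.1 ++ [q.2])).comp
          (ih.prodMk (hd _))
    exact (isClosed_discrete {v | Admissible e s v}).preimage hc

end Walk

/-! ### Nonemptiness -/

/-- A real number whose base-four digits are the doubled digits of `y`. -/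
theorem exists_slope (y : ℕ → ℕ) (hy : ∀ n, y n ≤ 1) :
    ∃ θ : ℝ, 0 ≤ θ ∧ θ < 1 ∧ ∀ n, ∃ M : ℕ, M % 2 = y n ∧
      (2 * M : ℝ) ≤ 4 ^ (n + 1) * θ ∧ 4 ^ (n + 1) * θ < 2 * M + 1 := by
  obtain ⟨M, hM_zero, hM⟩ : ∃ M : ℕ → ℕ, M 0 = y 0 ∧ ∀ n, M (n + 1) = 4 * M n + y (n + 1) :=
    ⟨fun n => Nat.rec (motive := fun _ => ℕ) (y 0) (fun m r => 4 * r + y (m + 1)) n, rfl,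
      fun _ => rfl⟩
  let a : ℕ → ℝ := fun n => 2 * (M n : ℝ) / 4 ^ (n + 1)
  let b : ℕ → ℝ := fun n => (2 * (M n : ℝ) + 2 / 3) / 4 ^ (n + 1)
  have ha : Monotone a := by
    refine monotone_nat_of_le_succ fun n => ?_
    simp only [a, hM, Nat.cast_add, Nat.cast_mul, Nat.cast_ofNat]
    rw [div_le_div_iff₀ (by positivity) (by positivity), pow_succ (4 : ℝ) (n + 1)]
    have : (0 : ℝ) ≤ y (n + 1) := Nat.cast_nonneg _
    have : (0 : ℝ) ≤ y (n + 1) * 4 ^ (n + 1) := by positivity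
    nlinarith
  have hb : Antitone b := by
    refine antitone_nat_of_succ_le fun n => ?_
    simp only [b, hM, Nat.cast_add, Nat.cast_mul, Nat.cast_ofNat]
    rw [div_le_div_iff₀ (by positivity) (by positivity), pow_succ (4 : ℝ) (n + 1)]
    have : (y (n + 1) : ℝ) ≤ 1 := by exact_mod_cast hy _
    have : (y (n + 1) : ℝ) * 4 ^ (n + 1) ≤ 1 * 4 ^ (n + 1) :=
      mul_le_mul_of_nonneg_right this (by positivity)
    nlinarith
  have hab : ∀ n, a n ≤ b n := fun n => by
    simp only [a, b]; gcongr; linarith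
  have hθ := Set.mem_iInter.1 (ha.ciSup_mem_iInter_Icc_of_antitone hb hab)
  set θ := ⨆ n, a n
  have hbound : ∀ n, (2 * M n : ℝ) ≤ 4 ^ (n + 1) * θ ∧ 4 ^ (n + 1) * θ ≤ 2 * M n + 2 / 3 := by
    intro n
    obtain ⟨h₁, h₂⟩ := hθ n
    simp only [a, b] at h₁ h₂
    rw [div_le_iff₀ (by positivity)] at h₁
    rw [le_div_iff₀ (by positivity)] at h₂
    constructor <;> linarith
  have h0 := hbound 0
  have hM0 : (M 0 : ℝ) ≤ 1 := by rw [hM_zero]; exact_mod_cast hy 0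
  have hM0' : (0 : ℝ) ≤ M 0 := Nat.cast_nonneg _
  refine ⟨θ, ?_, ?_, fun n => ⟨M n, ?_, (hbound n).1, ?_⟩⟩
  · norm_num at h0; linarith
  · norm_num at h0; linarith
  · have := hy n
    rcases n with _ | n
    · rw [hM_zero]; exact Nat.mod_eq_of_lt (by omega)
    · rw [hM]; omega
  · have := (hbound n).2; linarith

section WordNorm

variable {G : Type*} [Group G] {k : ℕ} {σ : Fin k → G}

theorem exists_list_prod (hσ : IsSymmGen σ) (g : G) :
    ∃ w : List (Fin k), (w.map σ).prod = g := by
  have hg : g ∈ Subgroup.closure (Set.range σ) := hσ.1 ▸ Subgroup.mem_top g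
  induction hg using Subgroup.closure_induction'' with
  | one => exact ⟨[], rfl⟩
  | mem x hx => obtain ⟨i, rfl⟩ := hx; exact ⟨[i], by simp⟩
  | inv_mem x hx =>
    obtain ⟨i, rfl⟩ := hx
    obtain ⟨j, hj⟩ := hσ.2 i
    exact ⟨[j], by simp [hj]⟩
  | mul x y _ _ hx hy =>
    obtain ⟨v, rfl⟩ := hx
    obtain ⟨w, rfl⟩ := hy
    exact ⟨v ++ w, by simp⟩

theorem exists_length_eq_wordNorm (hσ : IsSymmGen σ) (g : G) :
    ∃ w : List (Fin k), w.length = wordNorm σ g ∧ (w.map σ).prod = g := by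
  have : {n | ∃ w : List (Fin k), w.length = n ∧ (w.map σ).prod = g}.Nonempty := by
    obtain ⟨w, hw⟩ := exists_list_prod hσ g
    exact ⟨_, w, rfl, hw⟩
  exact Nat.sInf_mem this

theorem wordNorm_le (w : List (Fin k)) : wordNorm σ (w.map σ).prod ≤ w.length :=
  Nat.sInf_le ⟨w, rfl, rfl⟩

theorem wordNorm_mul_le (hσ : IsSymmGen σ) (g h : G) :
    wordNorm σ (g * h) ≤ wordNorm σ g + wordNorm σ h := by
  obtain ⟨v, hv, hvg⟩ := exists_length_eq_wordNorm hσ g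
  obtain ⟨w, hw, hwh⟩ := exists_length_eq_wordNorm hσ h
  have := wordNorm_le (σ := σ) (v ++ w)
  rwa [List.map_append, List.prod_append, hvg, hwh, List.length_append, hv, hw] at this

theorem exists_wordNorm_inv_mul (hσ : IsSymmGen σ) {h : G} (hh : h ≠ 1) :
    ∃ i, wordNorm σ h = wordNorm σ ((σ i)⁻¹ * h) + 1 := by
  obtain ⟨w, hw, hwh⟩ := exists_length_eq_wordNorm hσ h
  rcases w with _ | ⟨i, w⟩
  · exact absurd hwh.symm hh
  · refine ⟨i, ?_⟩
    have h₁ : (σ i)⁻¹ * h = (w.map σ).prod := by rw [← hwh]; simp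
    have h₂ := wordNorm_le (σ := σ) w
    have h₃ := wordNorm_mul_le hσ (σ i) ((σ i)⁻¹ * h)
    have h₄ := wordNorm_le (σ := σ) [i]
    simp only [List.map_cons, List.map_nil, List.prod_singleton, List.length_singleton] at h₄
    rw [mul_inv_cancel_left] at h₃
    rw [h₁] at h₃ ⊢
    simp only [List.length_cons] at hw
    omega

/-- A Busemann-type height function: from every point one can move up by one along a
generator. -/
theorem exists_height [Infinite G] (hσ : IsSymmGen σ) :
    ∃ b : G → ℤ, ∀ g, ∃ i, b (g * σ i) = b g + 1 := by
  let 𝓤 := Filter.hyperfilter G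
  let β : G → G → ℤ := fun t g => wordNorm σ t - wordNorm σ (g⁻¹ * t)
  have hlim : ∀ g, ∃ v : ℤ, ∀ᶠ t in (𝓤 : Filter G), β t g = v := by
    intro g
    have hfin : (Set.Icc (-(wordNorm σ g⁻¹ : ℤ)) (wordNorm σ g)).Finite := Set.finite_Icc _ _
    have hmem : ∀ᶠ t in (𝓤 : Filter G),
        ∃ v ∈ Set.Icc (-(wordNorm σ g⁻¹ : ℤ)) (wordNorm σ g), β t g = v := by
      refine Filter.Eventually.of_forall fun t => ⟨_, ⟨?_, ?_⟩, rfl⟩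
      · have := wordNorm_mul_le hσ g⁻¹ t
        simp only [β]; omega
      · have := wordNorm_mul_le hσ g (g⁻¹ * t)
        rw [mul_inv_cancel_left] at this
        simp only [β]; omega
    obtain ⟨v, -, hv⟩ := (Ultrafilter.eventually_exists_mem_iff hfin).1 hmem
    exact ⟨v, hv⟩
  choose b hb using hlim
  refine ⟨b, fun g => ?_⟩
  have h₁ : ∀ᶠ t in (𝓤 : Filter G), ∀ i, β t (g * σ i) = b (g * σ i) :=
    Filter.eventually_all.2 fun i => hb _
  have h₂ : ∀ᶠ t in (𝓤 : Filter G), t ≠ g :=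
    Filter.hyperfilter_le_cofinite (Set.finite_singleton g).compl_mem_cofinite
  obtain ⟨t, ⟨ht₁, ht₂⟩, ht₃⟩ := ((h₁.and h₂).and (hb g)).exists
  obtain ⟨i, hi⟩ := exists_wordNorm_inv_mul hσ (h := g⁻¹ * t) fun h =>
    ht₂ (inv_mul_eq_one.1 h).symm
  refine ⟨i, ?_⟩
  rw [← ht₁ i, ← ht₃]
  simp only [β, mul_inv_rev, mul_assoc]
  omega

theorem universalSubshift_nonempty [Infinite G] [NeZero k] (hσ : IsSymmGen σ) :
    (universalSubshift σ).Nonempty := by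
  obtain ⟨y, hy, hU⟩ := exists_universal
  obtain ⟨θ, hθ₀, hθ₁, hθ⟩ := exists_slope y hy
  obtain ⟨b, hb⟩ := exists_height hσ
  choose s hs using hb
  let c : G → ℕ := fun g => (⌊((b g : ℝ) + 1) * θ⌋ - ⌊(b g : ℝ) * θ⌋).toNat
  have hc : ∀ g, (c g : ℤ) = ⌊((b g : ℝ) + 1) * θ⌋ - ⌊(b g : ℝ) * θ⌋ ∧ c g ≤ 1 := by
    intro g
    have h₁ : ⌊(b g : ℝ) * θ⌋ ≤ ⌊((b g : ℝ) + 1) * θ⌋ := Int.floor_le_floor (by linarith)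
    have h₂ : ⌊((b g : ℝ) + 1) * θ⌋ ≤ ⌊(b g : ℝ) * θ⌋ + 1 := by
      rw [← Int.floor_add_one]; exact Int.floor_le_floor (by linarith)
    simp only [c]; omega
  let x : G → Fin (2 * k) := fun g => ⟨2 * s g + c g, by have := (hc g).2; omega⟩
  have hs_x : ∀ g, pointer k (x g) = s g := fun g => pointer_two_mul_add _ (hc g).2
  have hc_x : ∀ g, ((x g : ℕ) % 2) = c g := fun g => by
    have := (hc g).2
    change (2 * (s g : ℕ) + c g) % 2 = c g
    omega
  have hwalk : ∀ g i, b (walk σ x g i).1 = b g + i ∧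
      ((walk σ x g i).2 : ℤ) = ⌊((b g : ℝ) + i) * θ⌋ - ⌊(b g : ℝ) * θ⌋ := by
    intro g i
    induction i with
    | zero => simp [walk]
    | succ i ih =>
      obtain ⟨ih₁, ih₂⟩ := ih
      rw [walk_succ]
      have h₁ := (hc (walk σ x g i).1).1
      constructor
      · simp only [hs_x, hs, ih₁]; push_cast; ring
      · simp only [hc_x]
        rw [ih₁] at h₁
        push_cast at h₁ ⊢
        rw [ih₂, h₁, ← add_assoc]; ring
  refine ⟨x, fun g => ?_⟩
  convert hU using 1
  ext n
  obtain ⟨M, hM, h₁, h₂⟩ := hθ n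
  have hcount := (hwalk g (4 ^ (n + 1))).2
  push_cast at hcount
  rw [add_mul] at hcount
  have h₃ : ⌊(b g : ℝ) * θ⌋ + 2 * M ≤ ⌊(b g : ℝ) * θ + 4 ^ (n + 1) * θ⌋ := by
    rw [Int.le_floor]; push_cast
    have := Int.floor_le ((b g : ℝ) * θ); linarith
  have h₄ : ⌊(b g : ℝ) * θ + 4 ^ (n + 1) * θ⌋ < ⌊(b g : ℝ) * θ⌋ + 2 * M + 2 := by
    rw [Int.floor_lt]; push_cast
    have := Int.lt_floor_add_one ((b g : ℝ) * θ); linarith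
  rw [walkDigit]
  omega

end WordNorm

/-! ### Recursive presentations -/

/-- The word problem of a recursively presented group has a primitive recursive enumeration. -/
theorem RecursivelyPresented.exists_primrec {G : Type*} [Group G] {k : ℕ} {σ : Fin k → G}
    (h : RecursivelyPresented σ) :
    ∃ r : ℕ → List (Fin k × Bool), Primrec r ∧ ∀ w, wordVal σ w = 1 ↔ ∃ m, r m = w := by
  obtain ⟨f, hf, hfw⟩ := h
  obtain ⟨c, hc⟩ := Nat.Partrec.Code.exists_code.1 hf
  have hceval : ∀ n, c.eval n = Part.some (Encodable.encode (f n)) := fun n => by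
    rw [hc]; simp
  let r : ℕ → List (Fin k × Bool) := fun m =>
    (((c.evaln m.unpair.1 m.unpair.2).bind fun a =>
      (Encodable.decode a : Option (Option (List (Fin k × Bool))))).bind id).getD []
  refine ⟨r, ?_, fun w => ⟨fun hw => ?_, ?_⟩⟩
  · have h₁ : Primrec fun m : ℕ => c.evaln m.unpair.1 m.unpair.2 :=
      Nat.Partrec.Code.primrec_evaln.comp
        (((Primrec.fst.comp Primrec.unpair).pair (Primrec.const c)).pair
          (Primrec.snd.comp Primrec.unpair))
    exact Primrec.option_getD.comp (Primrec.option_bind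
      (Primrec.option_bind h₁ (Primrec.decode.comp Primrec.snd).to₂) Primrec.snd.to₂)
      (Primrec.const [])
  · obtain ⟨n, hn⟩ := (hfw w).1 hw
    have : Encodable.encode (f n) ∈ c.eval n := by rw [hceval]; exact Part.mem_some _
    obtain ⟨s, hs⟩ := Nat.Partrec.Code.evaln_complete.1 this
    refine ⟨Nat.pair s n, ?_⟩
    rw [Option.mem_def] at hs
    simp [r, hs, hn]
  · rintro ⟨m, rfl⟩
    rcases he : c.evaln m.unpair.1 m.unpair.2 with _ | a
    · simp [r, he, wordVal_nil]
    · have ha := Nat.Partrec.Code.evaln_sound he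
      rw [hceval, Part.mem_some_iff] at ha
      simp only [r, he, ha, Option.bind_some, Encodable.encodek, id]
      rcases hn : f m.unpair.2 with _ | w
      · exact wordVal_nil σ
      · exact (hfw w).2 ⟨_, hn⟩

/-! ### Codes of configurations -/

theorem encode_of_decode_eq_some {k n : ℕ} {w : List (Fin k × Bool)}
    (h : Encodable.decode n = some w) : Encodable.encode w = n := by
  induction n using Nat.strong_induction_on generalizing w with
  | _ n ih =>
  rcases n with _ | v
  · rw [Encodable.decode_list_zero] at h
    obtain rfl := Option.some.inj h
    rfl
  · rw [Encodable.decode_list_succ] at h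
    rcases h₁ : (Encodable.decode v.unpair.1 : Option (Fin k × Bool)) with _ | a
    · simp [h₁, Seq.seq] at h
    rcases h₂ : (Encodable.decode v.unpair.2 : Option (List (Fin k × Bool))) with _ | l
    · simp [h₁, h₂, Seq.seq] at h
    simp only [h₁, h₂] at h
    obtain rfl : a :: l = w := by simpa using h
    have hl := ih _ (Nat.lt_succ_of_le (Nat.unpair_right_le v)) h₂
    have ha : Encodable.encode a = v.unpair.1 := by
      obtain ⟨i, b⟩ := a
      rw [Encodable.decode_prod_val] at h₁
      rcases h₃ : (Encodable.decode v.unpair.1.unpair.1 : Option (Fin k)) with _ | i'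
      · simp [h₃] at h₁
      rcases h₄ : (Encodable.decode v.unpair.1.unpair.2 : Option Bool) with _ | b'
      · simp [h₃, h₄] at h₁
      simp only [h₃, h₄, Option.bind_some, Option.map_some, Option.some.injEq,
        Prod.mk.injEq] at h₁
      obtain ⟨rfl, rfl⟩ := h₁
      have hi : Encodable.encode i' = v.unpair.1.unpair.1 := by
        by_cases hlt : v.unpair.1.unpair.1 < k
        · have : (Encodable.decode v.unpair.1.unpair.1 : Option (Fin k)) = some ⟨_, hlt⟩ :=
            Encodable.encodek (⟨_, hlt⟩ : Fin k)
          rw [h₃] at this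
          rw [Option.some.inj this]; rfl
        · have : (Encodable.decode v.unpair.1.unpair.1 : Option (Fin k)) = none := by
            simp [Encodable.decode, Encodable.decodeSubtype, hlt]
          simp [this] at h₃
      have hb : Encodable.encode b' = v.unpair.1.unpair.2 := by
        by_cases hlt : 2 ≤ v.unpair.1.unpair.2
        · rw [Encodable.decode_ge_two _ hlt] at h₄; simp at h₄
        · generalize v.unpair.1.unpair.2 = j at h₄ hlt
          interval_cases j
          · rw [Encodable.decode_zero] at h₄; obtain rfl := Option.some.inj h₄; rfl
          · rw [Encodable.decode_one] at h₄; obtain rfl := Option.some.inj h₄; rfl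
      rw [Encodable.encode_prod_val, hi, hb, Nat.pair_unpair]
    rw [Encodable.encode_list_cons, ha, hl, Nat.pair_unpair]

/-- `z` is the code of a configuration of words over the alphabet `Fin N`. -/
def IsConf (k N : ℕ) (z : ℕ → ℕ) : Prop :=
  ∀ n, if (Encodable.decode n : Option (List (Fin k × Bool))).isSome then 1 ≤ z n ∧ z n ≤ N
    else z n = 0

section Conf

variable {k N : ℕ}

theorem decode_freeGroup (n : ℕ) : (Encodable.decode n : Option (FreeGroup (Fin k))) =
    (Encodable.decode n : Option (List (Fin k × Bool))).map FreeGroup.mk :=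
  (Option.map_eq_bind ..).symm

theorem confFun_encode (x : FreeGroup (Fin k) → Fin N) (w : List (Fin k × Bool)) :
    confFun x (Encodable.encode w) = x (FreeGroup.mk w) + 1 := by
  rw [confFun, decode_freeGroup, Encodable.encodek]; rfl

theorem isConf_confFun (x : FreeGroup (Fin k) → Fin N) : IsConf k N (confFun x) := by
  intro n
  rcases h : (Encodable.decode n : Option (List (Fin k × Bool))) with _ | w
  · simp [confFun, decode_freeGroup, h]
  · obtain rfl := encode_of_decode_eq_some h
    rw [confFun_encode]
    simp only [Option.isSome_some, if_true]
    have := (x (FreeGroup.mk w)).2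
    omega

theorem confFun_injective :
    Function.Injective (confFun : (FreeGroup (Fin k) → Fin N) → ℕ → ℕ) := by
  intro x y h
  ext g
  have := congrFun h (Encodable.encode g.toWord)
  rw [confFun_encode, confFun_encode, FreeGroup.mk_toWord] at this
  omega

theorem eq_confFun_iff {z : ℕ → ℕ} (hz : IsConf k N z) (x : FreeGroup (Fin k) → Fin N) :
    z = confFun x ↔ ∀ w : List (Fin k × Bool), z (Encodable.encode w) = x (FreeGroup.mk w) + 1 := by
  refine ⟨fun h w => by rw [h, confFun_encode], fun h => funext fun n => ?_⟩
  have hn := hz n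
  have hn' := isConf_confFun x n
  rcases hd : (Encodable.decode n : Option (List (Fin k × Bool))) with _ | w
  · simp_all
  · obtain rfl := encode_of_decode_eq_some hd
    rw [h, confFun_encode]

theorem mem_mSet_pullback_iff {G : Type*} [Group G] {σ : Fin k → G} {X : Set (G → Fin N)}
    {z : ℕ → ℕ} (hz : IsConf k N z) : z ∈ mSet (pullback (cover σ) X) ↔
      ∃ x ∈ X, ∀ w : List (Fin k × Bool), z (Encodable.encode w) = x (wordVal σ w) + 1 := by
  simp only [mSet, pullback, Set.image_image, Set.mem_image]
  refine exists_congr fun x => and_congr_right fun _ => ?_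
  rw [eq_comm, eq_confFun_iff hz]; rfl

end Conf

/-! ### A primitive recursive test for the universal subshift -/

section Test

variable {k : ℕ}

/-- The test for the universal subshift, given an enumeration `r` of the word problem: the digits
read from a word are admissible, and inserting relators does not change the letter. -/
def Test [NeZero k] (r : ℕ → List (Fin k × Bool)) (j : (List (Fin k × Bool) × ℕ) × (ℕ × ℕ))
    (l : List ℕ) : Prop :=
  Admissible j.2.1 j.2.2
      ((List.range j.2.2).map fun n => digit (fun c => l.getD c 0) j.1.1 (Nat.pair j.2.1 n)) ∧
    l.getD (Encodable.encode (j.1.1 ++ r j.1.2)) 0 = l.getD (Encodable.encode j.1.1) 0 ∧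
    l.getD (Encodable.encode (r j.1.2 ++ j.1.1)) 0 = l.getD (Encodable.encode j.1.1) 0

/-- The length of the prefix examined by `Test`. -/
def testUse (r : ℕ → List (Fin k × Bool)) (j : (List (Fin k × Bool) × ℕ) × (ℕ × ℕ)) : ℕ :=
  codeBound k (j.1.1.length + 4 ^ (Nat.pair j.2.1 j.2.2 + 1) + (r j.1.2).length) + 1

theorem primrec_testUse {r : ℕ → List (Fin k × Bool)} (hr : Primrec r) :
    Primrec (testUse r) := by
  have h₁ : Primrec fun j : (List (Fin k × Bool) × ℕ) × (ℕ × ℕ) => j.1.1.length :=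
    Primrec.list_length.comp (Primrec.fst.comp Primrec.fst)
  have h₂ : Primrec fun j : (List (Fin k × Bool) × ℕ) × (ℕ × ℕ) =>
      4 ^ (Nat.pair j.2.1 j.2.2 + 1) :=
    primrec_pow.comp (Primrec.const 4) (Primrec.succ.comp
      (Primrec₂.natPair.comp (Primrec.fst.comp Primrec.snd) (Primrec.snd.comp Primrec.snd)))
  have h₃ : Primrec fun j : (List (Fin k × Bool) × ℕ) × (ℕ × ℕ) => (r j.1.2).length :=
    Primrec.list_length.comp (hr.comp (Primrec.snd.comp Primrec.fst))
  exact Primrec.succ.comp ((primrec_codeBound k).comp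
    (Primrec.nat_add.comp (Primrec.nat_add.comp h₁ h₂) h₃))

theorem primrec_test [NeZero k] {r : ℕ → List (Fin k × Bool)} (hr : Primrec r) :
    PrimrecRel (Test r) := by
  let J := (List (Fin k × Bool) × ℕ) × (ℕ × ℕ)
  have hw : Primrec fun p : J × List ℕ => p.1.1.1 :=
    Primrec.fst.comp (Primrec.fst.comp Primrec.fst)
  have hm : Primrec fun p : J × List ℕ => r p.1.1.2 :=
    hr.comp (Primrec.snd.comp (Primrec.fst.comp Primrec.fst))
  have he : Primrec fun p : J × List ℕ => p.1.2.1 :=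
    Primrec.fst.comp (Primrec.snd.comp Primrec.fst)
  have hs : Primrec fun p : J × List ℕ => p.1.2.2 :=
    Primrec.snd.comp (Primrec.snd.comp Primrec.fst)
  have hget : ∀ {f : J × List ℕ → List (Fin k × Bool)}, Primrec f →
      Primrec fun p : J × List ℕ => p.2.getD (Encodable.encode (f p)) 0 := fun hf =>
    (Primrec.list_getD 0).comp Primrec.snd (Primrec.encode.comp hf)
  have hdig : Primrec fun p : J × List ℕ => (List.range p.1.2.2).map fun n =>
      digit (fun c => p.2.getD c 0) p.1.1.1 (Nat.pair p.1.2.1 n) := by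
    refine Primrec.list_map (Primrec.list_range.comp hs) ?_
    exact primrec_digit.comp (((Primrec.snd.comp Primrec.fst).pair (hw.comp Primrec.fst)).pair
      (Primrec₂.natPair.comp (he.comp Primrec.fst) Primrec.snd))
  refine PrimrecPred.and (primrec_admissible.comp ((he.pair hs).pair hdig)) (PrimrecPred.and ?_ ?_)
  · exact Primrec.eq.comp (hget (Primrec.list_append.comp hw hm)) (hget hw)
  · exact Primrec.eq.comp (hget (Primrec.list_append.comp hm hw)) (hget hw)

/-- Every group element is represented by a word over the generators. -/
theorem wordVal_surjective {G : Type*} [Group G] {σ : Fin k → G} (hσ : IsSymmGen σ) :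
    Function.Surjective (wordVal σ) := by
  intro g
  obtain ⟨w, rfl⟩ := exists_list_prod hσ g
  refine ⟨w.map fun i => (i, true), ?_⟩
  simp [wordVal, cover, Function.comp_def]

theorem test_pref_iff [NeZero k] (r : ℕ → List (Fin k × Bool)) (z : ℕ → ℕ)
    (j : (List (Fin k × Bool) × ℕ) × (ℕ × ℕ)) : Test r j (pref z (testUse r j)) ↔
      Admissible j.2.1 j.2.2 (pref (fun n => digit z j.1.1 (Nat.pair j.2.1 n)) j.2.2) ∧
        z (Encodable.encode (j.1.1 ++ r j.1.2)) = z (Encodable.encode j.1.1) ∧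
        z (Encodable.encode (r j.1.2 ++ j.1.1)) = z (Encodable.encode j.1.1) := by
  have hget : ∀ v : List (Fin k × Bool),
      v.length ≤ j.1.1.length + 4 ^ (Nat.pair j.2.1 j.2.2 + 1) + (r j.1.2).length →
      (pref z (testUse r j)).getD (Encodable.encode v) 0 = z (Encodable.encode v) := fun v hv =>
    getD_pref z (Nat.lt_succ_of_le (encode_le_codeBound hv))
  have hdig : ((List.range j.2.2).map fun n => digit (fun c => (pref z (testUse r j)).getD c 0)
      j.1.1 (Nat.pair j.2.1 n)) = pref (fun n => digit z j.1.1 (Nat.pair j.2.1 n)) j.2.2 := by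
    refine List.map_congr_left fun n hn => digit_congr fun v hv => hget v ?_
    have h₁ : Nat.pair j.2.1 n < Nat.pair j.2.1 j.2.2 :=
      Nat.pair_lt_pair_right _ (List.mem_range.1 hn)
    have h₂ : 4 ^ (Nat.pair j.2.1 n + 1) ≤ 4 ^ (Nat.pair j.2.1 j.2.2 + 1) :=
      Nat.pow_le_pow_right (by norm_num) (by omega)
    omega
  have h₄ : 0 < 4 ^ Nat.pair j.2.1 j.2.2 := by positivity
  rw [Test, hdig, hget _ (by simp only [List.length_append]; omega), hget _ (by omega),
    hget _ (by simp only [List.length_append]; omega)]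

theorem mem_mSet_universalSubshift_iff [NeZero k] {G : Type*} [Group G] {σ : Fin k → G}
    (hσ : IsSymmGen σ) {r : ℕ → List (Fin k × Bool)}
    (hr : ∀ w, wordVal σ w = 1 ↔ ∃ m, r m = w) {z : ℕ → ℕ} (hz : IsConf k (2 * k) z) :
    z ∈ mSet (pullback (cover σ) (universalSubshift σ)) ↔
      ∀ j, Test r j (pref z (testUse r j)) := by
  simp only [test_pref_iff, mem_mSet_pullback_iff hz]
  have hr' : ∀ m, wordVal σ (r m) = 1 := fun m => (hr _).2 ⟨m, rfl⟩
  constructor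
  · rintro ⟨x, hx, hxz⟩ ⟨⟨w, m⟩, e, s⟩
    refine ⟨?_, ?_, ?_⟩
    · rw [← walkDigit_eq_digit hxz]; exact hx _ e s
    · simp [hxz, wordVal_append, hr']
    · simp [hxz, wordVal_append, hr']
  · intro h
    have hsuffix : ∀ w v, wordVal σ v = 1 →
        z (Encodable.encode (w ++ v)) = z (Encodable.encode w) := fun w v hv => by
      obtain ⟨m, rfl⟩ := (hr v).1 hv
      exact (h ((w, m), 0, 0)).2.1
    have hprefix : ∀ w v, wordVal σ v = 1 →
        z (Encodable.encode (v ++ w)) = z (Encodable.encode w) := fun w v hv => by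
      obtain ⟨m, rfl⟩ := (hr v).1 hv
      exact (h ((w, m), 0, 0)).2.2
    have hinv : ∀ w, wordVal σ (FreeGroup.invRev w) = (wordVal σ w)⁻¹ := fun w => by
      rw [wordVal, ← FreeGroup.inv_mk, map_inv]; rfl
    have hcongr : ∀ v w, wordVal σ v = wordVal σ w →
        z (Encodable.encode v) = z (Encodable.encode w) := fun v w hvw => by
      rw [← hsuffix v (FreeGroup.invRev v ++ w) (by rw [wordVal_append, hinv, hvw]; simp),
        ← List.append_assoc, hprefix _ _ (by rw [wordVal_append, hinv]; simp)]
    choose W hW using wordVal_surjective hσ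
    have hzw : ∀ w : List (Fin k × Bool),
        1 ≤ z (Encodable.encode w) ∧ z (Encodable.encode w) ≤ 2 * k := fun w => by
      simpa using hz (Encodable.encode w)
    let x : G → Fin (2 * k) := fun g =>
      ⟨z (Encodable.encode (W g)) - 1, by have := hzw (W g); omega⟩
    have hx : ∀ w, z (Encodable.encode w) = x (wordVal σ w) + 1 := fun w => by
      have := hzw (W (wordVal σ w))
      rw [hcongr w (W (wordVal σ w)) (hW _).symm]
      change _ = z (Encodable.encode (W (wordVal σ w))) - 1 + 1
      omega
    refine ⟨x, fun g e s => ?_, hx⟩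
    rw [← hW g, walkDigit_eq_digit hx]
    exact (h ((W g, 0), e, s)).1

end Test

/-! ### Effectiveness -/

theorem primrec_reduce (k : ℕ) : Primrec (FreeGroup.reduce (α := Fin k)) := by
  let S := Fin k × Bool
  have hcancel : PrimrecPred fun p : (List S × (S × List S × List S)) × (S × List S) =>
      p.1.2.1.1 = p.2.1.1 ∧ p.1.2.1.2 = !p.2.1.2 := by
    refine PrimrecPred.and ?_ ?_
    · exact Primrec.eq.comp (Primrec.fst.comp (Primrec.fst.comp (Primrec.snd.comp Primrec.fst)))
        (Primrec.fst.comp (Primrec.fst.comp Primrec.snd))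
    · exact Primrec.eq.comp (Primrec.snd.comp (Primrec.fst.comp (Primrec.snd.comp Primrec.fst)))
        (Primrec.not.comp (Primrec.snd.comp (Primrec.fst.comp Primrec.snd)))
  have hhead : Primrec fun p : List S × (S × List S × List S) => p.2.1 :=
    Primrec.fst.comp Primrec.snd
  have hnext : Primrec₂ fun (p : List S × (S × List S × List S)) (c : S × List S) =>
      if p.2.1.1 = c.1.1 ∧ p.2.1.2 = !c.1.2 then c.2 else p.2.1 :: c.1 :: c.2 :=
    Primrec.ite hcancel (Primrec.snd.comp Primrec.snd)
      (Primrec.list_cons.comp (hhead.comp Primrec.fst)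
        (Primrec.list_cons.comp (Primrec.fst.comp Primrec.snd) (Primrec.snd.comp Primrec.snd)))
  have hstep : Primrec₂ fun (_ : List S) (q : S × List S × List S) =>
      (List.casesOn q.2.2 [q.1] fun hd tl =>
        if q.1.1 = hd.1 ∧ q.1.2 = !hd.2 then tl else q.1 :: hd :: tl : List S) :=
    Primrec.list_casesOn (Primrec.snd.comp (Primrec.snd.comp Primrec.snd))
      (Primrec.list_cons.comp hhead (Primrec.const [])) hnext
  refine (Primrec.list_rec Primrec.id (Primrec.const []) hstep).of_eq fun L => ?_
  rfl

section Effective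

variable {k N : ℕ}

/-- The condition on a configuration over `Fin N` that its encoding takes the value `a` at `c`,
as an entry of a coded pattern. -/
def entry (k N : ℕ) (c a : ℕ) : ℕ × ℕ :=
  ((Encodable.decode c : Option (List (Fin k × Bool))).map fun w =>
    (Encodable.encode (FreeGroup.reduce w), if a = 0 then N else a - 1)).getD
    (if a = 0 then (c, 0) else (0, N))

theorem primrec_entry (k N : ℕ) : Primrec₂ (entry k N) := by
  have h₀ : PrimrecPred fun p : ℕ × ℕ => p.2 = 0 := Primrec.eq.comp Primrec.snd (Primrec.const 0)
  refine Primrec.option_getD.comp (Primrec.option_map (Primrec.decode.comp Primrec.fst) ?_) ?_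
  · exact Primrec.pair (Primrec.encode.comp ((primrec_reduce k).comp Primrec.snd))
      ((Primrec.ite h₀ (Primrec.const N) (Primrec.pred.comp Primrec.snd)).comp Primrec.fst)
  · exact Primrec.ite h₀ (Primrec.fst.pair (Primrec.const 0)) (Primrec.const (0, N))

theorem codedCylinder_eq_empty : codedCylinder (k := k) (A := Fin N) [(0, N)] = ∅ := by
  refine Set.eq_empty_of_forall_notMem fun x hx => ?_
  have h : (x 1 : ℕ) = N := hx _ (List.mem_singleton_self _) 1 rfl
  have := (x 1).2
  omega

theorem entry_iff (x : FreeGroup (Fin k) → Fin N) (c a : ℕ) :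
    (∀ g : FreeGroup (Fin k), Encodable.encode g = (entry k N c a).1 →
      Encodable.encode (x g) = (entry k N c a).2) ↔ confFun x c = a := by
  rcases h : (Encodable.decode c : Option (List (Fin k × Bool))) with _ | w
  · have hx : confFun x c = 0 := by simpa [h] using isConf_confFun x c
    rw [hx]
    by_cases ha : a = 0
    · simp only [entry, h, ha, Option.map_none, Option.getD_none, if_true, iff_true]
      rintro g rfl
      have : (Encodable.decode (Encodable.encode g.toWord) : Option (List (Fin k × Bool))) =
        none := h
      simp at this
    · simp only [entry, h, ha, Option.map_none, Option.getD_none, if_false]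
      refine ⟨fun hg => ?_, fun h0 => absurd h0.symm ha⟩
      have h : (x 1 : ℕ) = N := hg 1 rfl
      have := (x 1).2
      omega
  · obtain rfl := encode_of_decode_eq_some h
    have henc : Encodable.encode (FreeGroup.reduce w) = Encodable.encode (FreeGroup.mk w) := by
      rw [← FreeGroup.toWord_mk]; rfl
    simp only [confFun_encode, entry, h, Option.map_some, Option.getD_some, henc,
      Encodable.encode_inj, forall_eq]
    change (x (FreeGroup.mk w) : ℕ) = _ ↔ _
    have := (x (FreeGroup.mk w)).2
    split_ifs <;> omega

theorem mem_codedCylinder_iff (x : FreeGroup (Fin k) → Fin N) (l : List ℕ) :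
    x ∈ codedCylinder ((List.range l.length).map fun c => entry k N c (l.getD c 0)) ↔
      pref (confFun x) l.length = l := by
  rw [← mem_cylinder_iff]
  simp only [codedCylinder, cylinder, Set.mem_ofPred_eq, List.forall_mem_map, List.mem_range,
    entry_iff]
  exact forall₂_congr fun c hc => by rw [List.getD_eq_getElem _ _ hc]

theorem isEffective_of_test {G : Type*} [Group G] {σ : Fin k → G} {X : Set (G → Fin N)}
    {ι : Type*} [Primcodable ι] {u : ι → ℕ} {T : ι → List ℕ → Prop} (hu : Primrec u)
    (hT : PrimrecRel T)
    (h : ∀ z, IsConf k N z →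
      (z ∈ mSet (pullback (cover σ) X) ↔ ∀ j, T j (pref z (u j)))) : IsEffective σ X := by
  classical
  have hbad : PrimrecPred fun p : ι × List ℕ => p.2.length = u p.1 ∧ ¬ T p.1 p.2 :=
    (Primrec.eq.comp (Primrec.list_length.comp Primrec.snd) (hu.comp Primrec.fst)).and hT.not
  let pat : List ℕ → List (ℕ × ℕ) := fun l =>
    (List.range l.length).map fun c => entry k N c (l.getD c 0)
  have hpat : Primrec pat := Primrec.list_map (Primrec.list_range.comp Primrec.list_length)
    ((primrec_entry k N).comp Primrec.snd ((Primrec.list_getD 0).comp Primrec.fst Primrec.snd))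
  let F : ι × List ℕ → List (ℕ × ℕ) := fun p =>
    if p.2.length = u p.1 ∧ ¬ T p.1 p.2 then pat p.2 else [(0, N)]
  have hF : Primrec F := Primrec.ite hbad (hpat.comp Primrec.snd) (Primrec.const _)
  refine ⟨fun m => ((Encodable.decode m).map F).getD [(0, N)], ?_, ?_⟩
  · exact (Primrec.option_getD.comp (Primrec.option_map Primrec.decode (hF.comp Primrec.snd).to₂)
      (Primrec.const _)).to_comp
  · ext x
    have hx : x ∈ pullback (cover σ) X ↔ ∀ j, T j (pref (confFun x) (u j)) := by
      rw [← h _ (isConf_confFun x), mSet, confFun_injective.mem_set_image]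
    rw [Set.mem_compl_iff, hx, Set.mem_iUnion]
    constructor
    · intro hcon
      push Not at hcon
      obtain ⟨j, hj⟩ := hcon
      refine ⟨Encodable.encode (j, pref (confFun x) (u j)), ?_⟩
      simp only [Encodable.encodek, Option.map_some, Option.getD_some, F]
      rw [if_pos ⟨length_pref _ _, hj⟩, mem_codedCylinder_iff, length_pref]
    · rintro ⟨m, hm⟩ hall
      rcases hd : (Encodable.decode m : Option (ι × List ℕ)) with _ | p
      · simp only [hd, Option.map_none, Option.getD_none, codedCylinder_eq_empty] at hm
        exact hm
      · simp only [hd, Option.map_some, Option.getD_some, F] at hm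
        split_ifs at hm with hc
        · rw [mem_codedCylinder_iff, hc.1] at hm
          apply hc.2
          rw [← hm]
          exact hall _
        · rw [codedCylinder_eq_empty] at hm
          exact hm

end Effective

/-! ### Binary coding of configurations -/

/-- Read the code of a configuration over `Fin N` off a binary sequence, with letters in unary. -/
def fromBinary (k N : ℕ) (y : ℕ → ℕ) (n : ℕ) : ℕ :=
  if (Encodable.decode n : Option (List (Fin k × Bool))).isSome then
    ((List.range (N - 1)).map fun i => y (Nat.pair n i)).sum + 1
  else 0

/-- Write a sequence in unary as a binary sequence. -/
def toBinary (z : ℕ → ℕ) (n : ℕ) : ℕ := if n.unpair.2 < z n.unpair.1 - 1 then 1 else 0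

section Binary

variable {k N : ℕ}

theorem primrec_fromBinary (k N : ℕ) :
    Primrec₂ fun (n : ℕ) (l : List ℕ) => fromBinary k N (fun c => l.getD c 0) n := by
  have hsum : Primrec (List.sum : List ℕ → ℕ) :=
    (Primrec.list_foldr Primrec.id (Primrec.const 0)
      (Primrec.nat_add.comp (Primrec.fst.comp Primrec.snd)
        (Primrec.snd.comp Primrec.snd)).to₂).of_eq fun _ => rfl
  refine Primrec.ite (Primrec.eq.comp (Primrec.option_isSome.comp
    (Primrec.decode.comp Primrec.fst)) (Primrec.const true)) ?_ (Primrec.const 0)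
  refine Primrec.succ.comp (hsum.comp (Primrec.list_map (Primrec.const _) ?_))
  exact (Primrec.list_getD 0).comp (Primrec.snd.comp Primrec.fst)
    (Primrec₂.natPair.comp (Primrec.fst.comp Primrec.fst) Primrec.snd)

theorem fromBinary_pref (k N : ℕ) (y : ℕ → ℕ) {n m : ℕ} (h : Nat.pair n N ≤ m) :
    fromBinary k N (fun c => (pref y m).getD c 0) n = fromBinary k N y n := by
  have : (List.range (N - 1)).map (fun i => (pref y m).getD (Nat.pair n i) 0) =
      (List.range (N - 1)).map fun i => y (Nat.pair n i) := by
    refine List.map_congr_left fun i hi => getD_pref y (lt_of_lt_of_le ?_ h)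
    have := List.mem_range.1 hi
    exact Nat.pair_lt_pair_right _ (by omega)
  rw [fromBinary, fromBinary, this]

theorem isConf_fromBinary (hN : 1 ≤ N) {y : ℕ → ℕ} (hy : y ∈ cantorSpace) :
    IsConf k N (fromBinary k N y) := by
  intro n
  have hsum : ((List.range (N - 1)).map fun i => y (Nat.pair n i)).sum ≤ N - 1 := by
    refine (List.sum_le_card_nsmul _ 1 fun a ha => ?_).trans (by simp)
    obtain ⟨i, -, rfl⟩ := List.mem_map.1 ha
    exact hy _
  unfold fromBinary
  split_ifs
  · omega
  · rfl

theorem toBinary_mem_cantorSpace (z : ℕ → ℕ) : toBinary z ∈ cantorSpace := fun n => by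
  unfold toBinary; split_ifs <;> omega

theorem fromBinary_toBinary {z : ℕ → ℕ} (hz : IsConf k N z) :
    fromBinary k N (toBinary z) = z := by
  have hsum : ∀ n m, ((List.range m).map fun i => toBinary z (Nat.pair n i)).sum =
      min (z n - 1) m := fun n m => by
    induction m with
    | zero => simp
    | succ m ih =>
      rw [List.range_succ, List.map_append, List.sum_append, ih]
      simp only [toBinary, Nat.unpair_pair, List.map_cons, List.map_nil, List.sum_singleton]
      split_ifs <;> omega
  ext n
  have := hz n
  rw [fromBinary, hsum]
  split_ifs at this ⊢ <;> omega

/-- The binary version of a set of codes of configurations. -/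
def binarySet (k N : ℕ) (M : Set (ℕ → ℕ)) : Set (ℕ → ℕ) :=
  {y | y ∈ cantorSpace ∧ fromBinary k N y ∈ M}

theorem toBinary_mem_binarySet {M : Set (ℕ → ℕ)} {z : ℕ → ℕ} (hz : IsConf k N z) (h : z ∈ M) :
    toBinary z ∈ binarySet k N M :=
  ⟨toBinary_mem_cantorSpace z, (fromBinary_toBinary hz).symm ▸ h⟩

theorem baireEquiv_binarySet {M : Set (ℕ → ℕ)} (hM : ∀ z ∈ M, IsConf k N z) :
    BaireEquiv M (binarySet k N M) := by
  constructor
  · refine BaireLE.of_use (u := fun n => Nat.pair n N)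
      (Primrec₂.natPair.comp Primrec.id (Primrec.const N)) (primrec_fromBinary k N)
      fun y hy => ?_
    simp only [fromBinary_pref k N y le_rfl]
    exact hy.2
  · refine BaireLE.of_use (u := fun n => n + 1)
      (g := fun n l => toBinary (fun c => l.getD c 0) n) Primrec.succ ?_ fun z hz => ?_
    · refine Primrec.ite (Primrec.nat_lt.comp
        (Primrec.snd.comp (Primrec.unpair.comp Primrec.fst)) (Primrec.pred.comp
          ((Primrec.list_getD 0).comp Primrec.snd
            (Primrec.fst.comp (Primrec.unpair.comp Primrec.fst)))))
        (Primrec.const 1) (Primrec.const 0)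
    · have : (fun n => toBinary (fun c => (pref z (n + 1)).getD c 0) n) = toBinary z := by
        ext n
        simp only [toBinary, getD_pref z (Nat.lt_succ_of_le (Nat.unpair_left_le n))]
      rw [this]
      exact toBinary_mem_binarySet (hM z hz) hz

theorem isPi01Cantor_binarySet (hN : 1 ≤ N) {M : Set (ℕ → ℕ)} {ι : Type*} [Primcodable ι]
    {u : ι → ℕ} {T : ι → List ℕ → Prop} (hu : Primrec u) (hT : PrimrecRel T)
    (h : ∀ z, IsConf k N z → (z ∈ M ↔ ∀ j, T j (pref z (u j)))) :
    IsPi01Cantor (binarySet k N M) := by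
  refine isPi01Cantor_of_test (u := fun j => Nat.pair (u j) N)
    (T := fun j l => T j (pref (fromBinary k N fun c => l.getD c 0) (u j)))
    (Primrec₂.natPair.comp hu (Primrec.const N)) ?_ (fun y hy => hy.1) fun y hy => ?_
  · exact PrimrecRel.comp hT Primrec.fst (Primrec.list_map
      (Primrec.list_range.comp (hu.comp Primrec.fst))
      ((primrec_fromBinary k N).comp Primrec.snd (Primrec.snd.comp Primrec.fst)))
  · have : ∀ j, pref (fromBinary k N fun c => (pref y (Nat.pair (u j) N)).getD c 0) (u j) =
        pref (fromBinary k N y) (u j) := fun j =>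
      pref_congr fun n hn => fromBinary_pref k N y (Nat.pair_lt_pair_left N hn).le
    simp only [this, ← h _ (isConf_fromBinary hN hy)]
    exact and_iff_right hy

end Binary

/-- Every nonempty `Π⁰₁` class is Medvedev reducible to the universal subshift. -/
theorem baireLE_mSet_universalSubshift {G : Type*} [Group G] {k : ℕ} [NeZero k] (σ : Fin k → G)
    {Q : Set (ℕ → ℕ)} (hQ : IsPi01Cantor Q) (hne : Q.Nonempty) :
    BaireLE Q (mSet (pullback (cover σ) (universalSubshift σ))) := by
  obtain ⟨e, he⟩ := exists_section_mem hQ hne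
  refine BaireLE.of_use (u := fun n => codeBound k (4 ^ (Nat.pair e n + 1)) + 1)
    (g := fun n l => digit (k := k) (fun c => l.getD c 0) [] (Nat.pair e n)) ?_ ?_ ?_
  · exact Primrec.succ.comp ((primrec_codeBound k).comp (primrec_pow.comp (Primrec.const 4)
      (Primrec.succ.comp (Primrec₂.natPair.comp (Primrec.const e) Primrec.id))))
  · exact primrec_digit.comp ((Primrec.snd.pair (Primrec.const [])).pair
      (Primrec₂.natPair.comp (Primrec.const e) Primrec.fst))
  · rintro z hz
    obtain ⟨x, -, rfl⟩ := id hz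
    obtain ⟨x', hx', hz'⟩ := (mem_mSet_pullback_iff (isConf_confFun x)).1 hz
    have := he _ (fun n => digit_le_one (confFun x) [] n)
      (walkDigit_eq_digit hz' [] ▸ hx' (wordVal σ []))
    convert this using 2 with n
    refine digit_congr fun v hv => getD_pref _ (Nat.lt_succ_of_le (encode_le_codeBound ?_))
    simp only [List.length_nil] at hv
    omega

/-- Every infinite, finitely generated and recursively presented group admits a nonempty
effective subshift which achieves the maximal `Π⁰₁` Medvedev degree. -/
theorem statement9 {G : Type*} [Group G] [Infinite G] {k : ℕ} (σ : Fin k → G)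
    (hσ : IsSymmGen σ) (hrp : RecursivelyPresented σ) :
    ∃ (n : ℕ) (X : Set (G → Fin n)), IsSubshift X ∧ IsEffective σ X ∧ X.Nonempty ∧
      ∃ P : Set (ℕ → ℕ), IsMaxPi01 P ∧ BaireEquiv (mSet (pullback (cover σ) X)) P := by
  have : NeZero k := ⟨fun hk => by
    subst hk
    obtain ⟨g, hg⟩ := exists_ne (1 : G)
    obtain ⟨w, rfl⟩ := exists_list_prod hσ g
    rcases w with _ | ⟨i, -⟩
    · exact hg rfl
    · exact i.elim0⟩
  obtain ⟨r, hr, hrw⟩ := hrp.exists_primrec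
  have htest := fun z hz => mem_mSet_universalSubshift_iff hσ hrw (z := z) hz
  have hconf : ∀ z ∈ mSet (pullback (cover σ) (universalSubshift σ)), IsConf k (2 * k) z := by
    rintro _ ⟨x, -, rfl⟩
    exact isConf_confFun x
  have hk : 1 ≤ 2 * k := by have := NeZero.ne k; omega
  have hne := universalSubshift_nonempty hσ
  have hequiv := baireEquiv_binarySet hconf
  refine ⟨2 * k, universalSubshift σ, isSubshift_universalSubshift σ,
    isEffective_of_test (primrec_testUse hr) (primrec_test hr) htest, hne,
    binarySet k (2 * k) (mSet (pullback (cover σ) (universalSubshift σ))),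
    ⟨isPi01Cantor_binarySet hk (primrec_testUse hr) (primrec_test hr) htest, ?_, fun Q hQ hQne =>
      (baireLE_mSet_universalSubshift σ hQ hQne).trans hequiv.1⟩, hequiv⟩
  obtain ⟨z, hz⟩ : (mSet (pullback (cover σ) (universalSubshift σ))).Nonempty :=
    (hne.image _).image _
  exact ⟨_, toBinary_mem_binarySet (hconf z hz) hz⟩

end MedvedevFormal
end

section
/- For every finitely generated virtually free group G (a group with a free subgroup of finite index), M_SFT(G) = M_sof(G) = {0_M}; that is, every nonempty SFT and every nonempty sofic subshift on G has trivial Medvedev degree (its pullback contains a computable configuration). -/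
namespace MedvedevFormal

/-! ### Computability lemmas -/

theorem computable_pref {y : ℕ → ℕ} (hy : Computable y) : Computable (pref y) := by
  have h : Computable fun n : ℕ =>
      Nat.rec (motive := fun _ => List ℕ) [] (fun i l => l ++ [y i]) n :=
    Computable.nat_rec (h := fun _ p => p.2 ++ [y p.1]) Computable.id (Computable.const [])
      (Computable.list_concat.comp (Computable.snd.comp Computable.snd)
        (hy.comp (Computable.fst.comp Computable.snd))).to₂
  refine h.of_eq fun n => ?_
  induction n with
  | zero => rfl
  | succ n ih =>
    change _ ++ [y n] = _
    rw [ih, pref, pref, List.range_succ, List.map_append, List.map_singleton]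

theorem pref_mono (y : ℕ → ℕ) {m n : ℕ} (h : m ≤ n) : pref y m <+: pref y n := by
  obtain ⟨d, rfl⟩ := Nat.exists_eq_add_of_le h
  rw [pref, pref, List.range_add, List.map_append]
  exact List.prefix_append _ _

theorem IsZeroDeg.baireLE {P : Set (ℕ → ℕ)} (hP : IsZeroDeg P) (Q : Set (ℕ → ℕ)) :
    BaireLE P Q := by
  obtain ⟨y, hyP, hy⟩ := hP
  refine ⟨fun l => pref y l.length, (computable_pref hy).comp Computable.list_length,
    fun l₁ l₂ h => pref_mono y h.length_le, fun x _ => ⟨y, hyP, fun n => ⟨n + 1, ?_⟩⟩⟩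
  simp [pref]

theorem IsZeroDeg.of_baireLE {P Q : Set (ℕ → ℕ)} (hQ : IsZeroDeg Q) (h : BaireLE P Q) :
    IsZeroDeg P := by
  obtain ⟨x, hxQ, hx⟩ := hQ
  obtain ⟨φ, hφ, hmono, hred⟩ := h
  obtain ⟨y, hyP, hy⟩ := hred x hxQ
  have hc : Computable₂ fun n k : ℕ => (φ (pref x k))[n]? :=
    (Computable.list_getElem?.comp
      (hφ.comp ((computable_pref hx).comp Computable.snd)) Computable.fst).to₂
  refine ⟨y, hyP, (Partrec.rfindOpt hc).of_eq_tot fun n => ?_⟩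
  rw [Nat.rfindOpt_mono]
  · exact hy n
  · intro a i j hij ha
    obtain ⟨l, hl⟩ := hmono _ _ (pref_mono x hij)
    rw [Option.mem_def] at ha ⊢
    rw [← hl, List.getElem?_append_left (List.getElem?_eq_some_iff.1 ha).1, ha]

theorem IsZeroDeg.baireEquiv_iff {P Q : Set (ℕ → ℕ)} (hP : IsZeroDeg P) :
    BaireEquiv P Q ↔ IsZeroDeg Q :=
  ⟨fun h => hP.of_baireLE h.2, fun h => ⟨hP.baireLE Q, h.baireLE P⟩⟩

theorem primrec_reduce_s11 (r : ℕ) :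
    Primrec (FreeGroup.reduce : List (Fin r × Bool) → List (Fin r × Bool)) := by
  have hstep : Primrec₂ fun (_ : List (Fin r × Bool))
      (p : (Fin r × Bool) × List (Fin r × Bool)) =>
      (List.casesOn p.2 [p.1] fun hd tl =>
        if p.1.1 = hd.1 ∧ p.1.2 = !hd.2 then tl else p.1 :: hd :: tl :
          List (Fin r × Bool)) := by
    have hp : Primrec fun a : List (Fin r × Bool) × (Fin r × Bool) × List (Fin r × Bool) =>
        a.2.1 := Primrec.fst.comp Primrec.snd
    refine Primrec.list_casesOn
      (h := fun a b => if a.2.1.1 = b.1.1 ∧ a.2.1.2 = !b.1.2 then b.2 else a.2.1 :: b.1 :: b.2)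
      (Primrec.snd.comp Primrec.snd) (Primrec.list_cons.comp hp (Primrec.const [])) ?_
    have hp' := hp.comp (Primrec.fst (β := (Fin r × Bool) × List (Fin r × Bool)))
    have hhd := (Primrec.fst.comp Primrec.snd :
      Primrec fun q : (List (Fin r × Bool) × (Fin r × Bool) × List (Fin r × Bool)) ×
        ((Fin r × Bool) × List (Fin r × Bool)) => q.2.1)
    have htl := (Primrec.snd.comp Primrec.snd :
      Primrec fun q : (List (Fin r × Bool) × (Fin r × Bool) × List (Fin r × Bool)) ×
        ((Fin r × Bool) × List (Fin r × Bool)) => q.2.2)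
    refine Primrec.ite (PrimrecPred.and ?_ ?_) htl
      (Primrec.list_cons.comp hp' (Primrec.list_cons.comp hhd htl))
    · exact Primrec.eq.comp (Primrec.fst.comp hp') (Primrec.fst.comp hhd)
    · exact Primrec.eq.comp (Primrec.snd.comp hp') (Primrec.not.comp (Primrec.snd.comp hhd))
  refine (Primrec.list_foldr Primrec.id (Primrec.const []) hstep).of_eq fun L => ?_
  induction L with
  | nil => rfl
  | cons a L ih =>
    rw [FreeGroup.reduce.cons, ← ih]
    rfl

theorem computablePoint_of_computable {k n : ℕ} {x : FreeGroup (Fin k) → Fin n}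
    (hx : Computable fun l : List (Fin k × Bool) => x (FreeGroup.mk l)) :
    ComputablePoint x := by
  have h : Computable fun i : ℕ => Encodable.encode
      ((Encodable.decode (α := List (Fin k × Bool)) i).map fun l => x (FreeGroup.mk l)) :=
    Computable.encode.comp (Computable.option_map Computable.decode (hx.comp Computable.snd).to₂)
  refine h.of_eq fun i => congrArg Encodable.encode ?_
  change _ = Option.map x ((Encodable.decode (α := List (Fin k × Bool)) i).bind _)
  cases Encodable.decode (α := List (Fin k × Bool)) i <;> rfl

theorem exists_computable_fullShift {G : Type*} [Group G] {k : ℕ} (σ : Fin k → G) :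
    ∃ x ∈ pullback (cover σ) (Set.univ : Set (G → Fin 1)), ComputablePoint x :=
  ⟨_, ⟨fun _ => 0, Set.mem_univ _, rfl⟩, computablePoint_of_computable (Computable.const 0)⟩

theorem isZeroDeg_mSet {k n : ℕ} {X : Set (FreeGroup (Fin k) → Fin n)}
    (h : ∃ x ∈ X, ComputablePoint x) : IsZeroDeg (mSet X) :=
  let ⟨x, hx, hc⟩ := h
  ⟨confFun x, ⟨x, hx, rfl⟩, hc⟩

/-! ### Virtually free groups -/

theorem finite_of_fg_freeGroup (I : Type*) [h : Group.FG (FreeGroup I)] : Finite I := by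
  classical
  obtain ⟨S, hS, hfin⟩ := Group.fg_iff.1 h
  have : Finite S := hfin
  have hinj : Function.Injective fun (i : I) (s : S) =>
      FreeGroup.lift (fun j => if j = i then Multiplicative.ofAdd (1 : ZMod 2) else 1) s.1 := by
    intro i j hij
    have : FreeGroup.lift (fun l => if l = i then Multiplicative.ofAdd (1 : ZMod 2) else 1) =
        FreeGroup.lift (fun l => if l = j then Multiplicative.ofAdd (1 : ZMod 2) else 1) :=
      MonoidHom.eq_of_eqOn_dense hS fun s hs => congrFun hij ⟨s, hs⟩
    have hi := DFunLike.congr_fun this (FreeGroup.of i)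
    by_contra hne
    simp [hne] at hi
  have : Finite (Multiplicative (ZMod 2)) := inferInstanceAs (Finite (ZMod 2))
  exact Finite.of_injective _ hinj

/-- A finitely generated virtually free group is a finite union of right cosets of a free
subgroup of finite rank. -/
theorem exists_free_coordinates {G : Type*} [Group G] {k : ℕ} (σ : Fin k → G)
    (hσ : IsSymmGen σ) (hvf : ∃ K : Subgroup G, K.FiniteIndex ∧ IsFreeGroup ↥K) :
    ∃ (r m : ℕ) (κ : FreeGroup (Fin r) →* G) (t : Fin m → G),
      Function.Bijective fun p : FreeGroup (Fin r) × Fin m => κ p.1 * t p.2 := by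
  obtain ⟨K, hK, hfree⟩ := hvf
  have : Group.FG G := Group.fg_iff.2 ⟨_, hσ.1, Set.finite_range σ⟩
  have : Group.FG K := inferInstance
  let e := IsFreeGroup.toFreeGroup K
  have : Group.FG (FreeGroup (IsFreeGroup.Generators K)) :=
    Group.fg_of_surjective (f := e.toMonoidHom) e.surjective
  have := finite_of_fg_freeGroup (IsFreeGroup.Generators K)
  obtain ⟨r, ⟨er⟩⟩ := Finite.exists_equiv_fin (IsFreeGroup.Generators K)
  obtain ⟨T, hT, -⟩ := K.exists_isComplement_right 1
  have : Finite T := hT.finite_right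
  obtain ⟨m, ⟨em⟩⟩ := Finite.exists_equiv_fin T
  let f : FreeGroup (Fin r) ≃* K := (FreeGroup.freeGroupCongr er.symm).trans e.symm
  refine ⟨r, m, K.subtype.comp f.toMonoidHom, fun i => em.symm i, ?_⟩
  exact hT.comp (f.toEquiv.prodCongr em.symm).bijective

/-! ### Configurations generated by an automaton on a free group -/

theorem toWord_mul_singleton {α : Type*} [DecidableEq α] (h : FreeGroup α) (s : α × Bool) :
    (h * FreeGroup.mk [s]).toWord = h.toWord ++ [s] ∨
      h.toWord = (h * FreeGroup.mk [s]).toWord ++ [(s.1, !s.2)] := by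
  have hred : FreeGroup.IsReduced h.toWord := FreeGroup.isReduced_toWord
  have hmul : h * FreeGroup.mk [s] = FreeGroup.mk (h.toWord ++ [s]) := by
    rw [← FreeGroup.mul_mk, FreeGroup.mk_toWord]
  by_cases hlast : h.toWord.getLast? = some (s.1, !s.2)
  · right
    obtain ⟨L, hL⟩ := List.getLast?_eq_some_iff.1 hlast
    have hcancel : h * FreeGroup.mk [s] = FreeGroup.mk L := by
      rw [hmul, hL, List.append_assoc]
      refine Quot.sound ?_
      simpa using FreeGroup.Red.Step.not (L₁ := L) (L₂ := []) (x := s.1) (b := !s.2)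
    have hLred : FreeGroup.IsReduced L :=
      (List.isChain_append.1 (hL ▸ hred : FreeGroup.IsReduced (L ++ [(s.1, !s.2)]))).1
    rw [hcancel, FreeGroup.toWord_mk, hLred.reduce_eq, hL]
  · left
    rw [hmul, FreeGroup.toWord_mk]
    refine FreeGroup.IsReduced.reduce_eq ?_
    refine List.isChain_append.2 ⟨hred, List.isChain_singleton s, ?_⟩
    rintro ⟨a, b⟩ hx y hy hay
    obtain rfl : s = y := by simpa using hy
    have hx : h.toWord.getLast? = some (a, b) := hx
    by_contra hb
    apply hlast
    rw [hx]
    obtain ⟨c, d⟩ := s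
    cases b <;> cases d <;> simp_all

theorem mk_singleton_mul_mk_not {α : Type*} (s : α × Bool) :
    FreeGroup.mk [s] * FreeGroup.mk [(s.1, !s.2)] = 1 := by
  have h : (FreeGroup.mk [s])⁻¹ = FreeGroup.mk [(s.1, !s.2)] := by
    simp [FreeGroup.inv_mk, FreeGroup.invRev]
  rw [← h, mul_inv_cancel]

theorem IsSFT.shift_mem {G A : Type*} [Group G] {Y : Set (G → A)} (hY : IsSFT Y)
    {y : G → A} (hy : y ∈ Y) (g : G) : shift g y ∈ Y := by
  obtain ⟨F, rfl⟩ := hY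
  intro p hp g' hm
  refine hy p hp (g' * g) fun h => ?_
  rw [← hm h]
  simp [shift, mul_assoc]

/-- Finitely many elements of `Y` realize all restrictions of elements of `Y` to a finite set. -/
theorem exists_finite_representatives {G A : Type*} [Finite A] (Y : Set (G → A))
    {B : Set G} (hB : B.Finite) :
    ∃ (N : ℕ) (c : Fin N → G → A), (∀ q, c q ∈ Y) ∧ ∀ y ∈ Y, ∃ q, ∀ b ∈ B, c q b = y b := by
  have : Finite B := hB
  have : Finite ((fun (y : G → A) (b : B) => y b) '' Y) := Set.toFinite _
  obtain ⟨N, ⟨e⟩⟩ := Finite.exists_equiv_fin ((fun (y : G → A) (b : B) => y b) '' Y)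
  choose c hc using fun q => (e.symm q).2
  refine ⟨N, c, fun q => (hc q).1, fun y hy => ⟨e ⟨_, y, hy, rfl⟩, fun b hb => ?_⟩⟩
  have := congrFun (hc (e ⟨_, y, hy, rfl⟩)).2 ⟨b, hb⟩
  simpa using this

/-- A nonempty subshift of finite type on a group which is a finite union of right cosets of a
free subgroup contains a configuration whose restrictions to the translates of a given finite
set are computed by a finite automaton reading reduced words. -/
theorem exists_automatic_configuration {G A : Type*} [Group G] [Finite A] {r m : ℕ}
    {κ : FreeGroup (Fin r) →* G} {t : Fin m → G}
    (hκt : Function.Bijective fun p : FreeGroup (Fin r) × Fin m => κ p.1 * t p.2)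
    {Y : Set (G → A)} (hY : IsSFT Y) (hne : Y.Nonempty) {D : Set G} (hD : D.Finite) :
    ∃ (N : ℕ) (c : Fin N → G → A) (next : Fin N → Fin r × Bool → Fin N) (q₀ : Fin N),
      (∀ q, c q ∈ Y) ∧ ∃ y ∈ Y, ∀ h : FreeGroup (Fin r), ∀ b ∈ D,
        y (κ h * b) = c (h.toWord.foldl next q₀) b := by
  classical
  obtain ⟨F, hF⟩ := id hY
  let D' : Set G := D ∪ Set.range t ∪ ⋃ p ∈ F, ⋃ i, (fun d => t i * d) '' p.dom
  have hD' : D'.Finite := by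
    refine (hD.union (Set.finite_range t)).union ?_
    exact (List.finite_toSet F).biUnion fun p _ => Set.finite_iUnion fun i =>
      p.dom.finite_toSet.image _
  let ball (R : ℕ) : Set G := {g | ∃ (w : List (Fin r × Bool)) (i : Fin m),
    w.length ≤ R ∧ g = κ (FreeGroup.mk w) * t i}
  have hball (R : ℕ) : (ball R).Finite := by
    refine (((List.finite_length_le (Fin r × Bool) R).prod (Set.finite_univ (α := Fin m))).image
      fun p => κ (FreeGroup.mk p.1) * t p.2).subset ?_
    rintro _ ⟨w, i, hw, rfl⟩
    exact ⟨(w, i), ⟨hw, trivial⟩, rfl⟩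
  have hcover (g : G) : ∃ R, g ∈ ball R := by
    obtain ⟨⟨h, i⟩, rfl⟩ := hκt.2 g
    exact ⟨_, h.toWord, i, le_rfl, by rw [FreeGroup.mk_toWord]⟩
  obtain ⟨R, hR⟩ : ∃ R, D' ⊆ ball R := by
    choose f hf using hcover
    obtain ⟨R, hR⟩ := (hD'.image f).bddAbove
    refine ⟨R, fun g hg => ?_⟩
    obtain ⟨w, i, hw, hg'⟩ := hf g
    exact ⟨w, i, hw.trans (hR ⟨g, hg, rfl⟩), hg'⟩
  obtain ⟨N, c, hc, hrep⟩ := exists_finite_representatives Y (hball R)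
  obtain ⟨y₀, hy₀⟩ := hne
  obtain ⟨q₀, -⟩ := hrep y₀ hy₀
  have hnext (q : Fin N) (s : Fin r × Bool) :
      ∃ q', ∀ b ∈ ball R, c q' b = c q (κ (FreeGroup.mk [s]) * b) := by
    obtain ⟨q', hq'⟩ := hrep _ (hY.shift_mem (hc q) (κ (FreeGroup.mk [s]))⁻¹)
    exact ⟨q', fun b hb => by rw [hq' b hb, shift, inv_inv]⟩
  choose next hnext using hnext
  let state (h : FreeGroup (Fin r)) : Fin N := h.toWord.foldl next q₀
  have hstep (h : FreeGroup (Fin r)) (s : Fin r × Bool) (b : G) (hb : b ∈ ball R)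
      (hsb : κ (FreeGroup.mk [s]) * b ∈ ball R) :
      c (state (h * FreeGroup.mk [s])) b = c (state h) (κ (FreeGroup.mk [s]) * b) := by
    rcases toWord_mul_singleton h s with hw | hw
    · have : state (h * FreeGroup.mk [s]) = next (state h) s := by
        simp only [state, hw, List.foldl_append, List.foldl_cons, List.foldl_nil]
      rw [this, hnext _ _ _ hb]
    · have : state h = next (state (h * FreeGroup.mk [s])) (s.1, !s.2) := by
        simp only [state]
        conv_lhs => rw [hw]
        simp only [List.foldl_append, List.foldl_cons, List.foldl_nil]
      have hinv : FreeGroup.mk [(s.1, !s.2)] * FreeGroup.mk [s] = 1 :=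
        mul_eq_one_comm.1 (mk_singleton_mul_mk_not s)
      rw [this, hnext _ _ _ hsb, ← mul_assoc, ← map_mul, hinv, map_one, one_mul]
  have hwalk (i : Fin m) (w : List (Fin r × Bool)) (hw : w.length ≤ R)
      (h : FreeGroup (Fin r)) :
      c (state (h * FreeGroup.mk w)) (t i) = c (state h) (κ (FreeGroup.mk w) * t i) := by
    induction w generalizing h with
    | nil => rw [← FreeGroup.one_eq_mk, mul_one, map_one, one_mul]
    | cons s w ih =>
      have hmk : FreeGroup.mk (s :: w) = FreeGroup.mk [s] * FreeGroup.mk w := by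
        rw [FreeGroup.mul_mk, List.singleton_append]
      have hw' : w.length ≤ R := (Nat.le_succ _).trans hw
      rw [hmk, ← mul_assoc, ih hw', map_mul, mul_assoc]
      refine hstep h s _ ⟨w, i, hw', rfl⟩ ⟨s :: w, i, hw, ?_⟩
      rw [hmk, map_mul, mul_assoc]
  let E := Equiv.ofBijective _ hκt
  let y : G → A := fun g => c (state (E.symm g).1) (t (E.symm g).2)
  have hyt (h : FreeGroup (Fin r)) (i : Fin m) : y (κ h * t i) = c (state h) (t i) := by
    have : E.symm (κ h * t i) = (h, i) := E.symm_apply_eq.2 rfl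
    simp only [y, this]
  have hyball (h : FreeGroup (Fin r)) (b : G) (hb : b ∈ ball R) :
      y (κ h * b) = c (state h) b := by
    obtain ⟨w, i, hw, rfl⟩ := hb
    rw [← mul_assoc, ← map_mul, hyt, hwalk i w hw]
  refine ⟨N, c, next, q₀, hc, y, ?_, fun h b hb => hyball h b (hR (Or.inl (Or.inl hb)))⟩
  rw [hF]
  intro p hp g hm
  obtain ⟨⟨h, i⟩, hg⟩ := hκt.2 g⁻¹
  have hcq := hc (state h)
  rw [hF] at hcq
  refine hcq p hp (t i)⁻¹ fun d => ?_
  rw [← hm d, shift, shift, inv_inv, ← hg, mul_assoc]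
  refine (hyball h _ (hR (Or.inr ?_))).symm
  simp only [Set.mem_iUnion]
  exact ⟨p, hp, i, d, d.2, rfl⟩

/-! ### Sofic subshifts -/

theorem IsSFT.isClosed {G A : Type*} [Group G] {Y : Set (G → A)} (hY : IsSFT Y) :
    @IsClosed (G → A) (prodiscrete G A) Y := by
  let _ : TopologicalSpace A := ⊥
  have _ : DiscreteTopology A := ⟨rfl⟩
  obtain ⟨F, rfl⟩ := hY
  change IsClosed {x : G → A | ∀ p ∈ F, ∀ g : G, ¬MatchesAt p g x}
  simp only [Set.ofPred_forall]
  refine isClosed_iInter fun p => isClosed_iInter fun _ => isClosed_iInter fun g => ?_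
  rw [← isOpen_compl_iff]
  have : {x : G → A | ¬MatchesAt p g x}ᶜ =
      ⋂ h : {g' // g' ∈ p.dom}, (fun x : G → A => x (g⁻¹ * h)) ⁻¹' {p.val h} := by
    ext x
    simp [MatchesAt, shift]
  rw [this]
  exact isOpen_iInter_of_finite fun h => (isOpen_discrete _).preimage (continuous_apply _)

/-- A map that is continuous on a closed set of configurations depends, at a given position, on
finitely many coordinates. -/
theorem exists_finite_window {G A B : Type*} [Finite B] {Y : Set (G → B)}
    (hY : @IsClosed (G → B) (prodiscrete G B) Y) {φ : (G → B) → (G → A)}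
    (hφ : @ContinuousOn (G → B) (G → A) (prodiscrete G B) (prodiscrete G A) φ Y) (a : G) :
    ∃ D : Set G, D.Finite ∧
      ∀ y ∈ Y, ∀ z ∈ Y, (∀ d ∈ D, y d = z d) → φ y a = φ z a := by
  let _ : TopologicalSpace B := ⊥
  have _ : DiscreteTopology B := ⟨rfl⟩
  let _ : TopologicalSpace A := ⊥
  have _ : DiscreteTopology A := ⟨rfl⟩
  have hcomp : IsCompact Y := IsClosed.isCompact hY
  have hcont : ContinuousOn (fun y => φ y a) Y := (continuous_apply a).comp_continuousOn hφ
  have hloc (y : G → B) (hy : y ∈ Y) :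
      ∃ D : Finset G, ∀ z ∈ Y, (∀ d ∈ D, z d = y d) → φ z a = φ y a := by
    have h := hcont y hy
    rw [ContinuousWithinAt, nhds_discrete, Filter.tendsto_pure, eventually_nhdsWithin_iff,
      nhds_pi, Filter.eventually_iff, Filter.mem_pi] at h
    obtain ⟨I, hI, u, hu, hsub⟩ := h
    refine ⟨hI.toFinset, fun z hz hzy => hsub (fun d hd => ?_) hz⟩
    rw [hzy d (hI.mem_toFinset.2 hd)]
    exact mem_of_mem_nhds (hu d)
  choose! D hD using hloc
  have hopen (y : G → B) : IsOpen {z : G → B | ∀ d ∈ D y, z d = y d} := by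
    simp only [Set.ofPred_forall]
    refine isOpen_biInter_finset fun d _ => ?_
    exact (isOpen_discrete ({y d} : Set B)).preimage
      (continuous_apply (A := fun _ : G => B) d)
  obtain ⟨T, hTY, hT⟩ := hcomp.elim_nhds_subcover (fun y => {z | ∀ d ∈ D y, z d = y d})
    fun y _ => (hopen y).mem_nhds fun _ _ => rfl
  refine ⟨⋃ y ∈ T, D y, T.finite_toSet.biUnion fun y _ => (D y).finite_toSet,
    fun y hy z hz hyz => ?_⟩
  obtain ⟨x, hxT, hx⟩ := Set.mem_iUnion₂.1 (hT hy)
  rw [hD x (hTY x hxT) y hy hx, hD x (hTY x hxT) z hz fun d hd => ?_]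
  rw [← hyz d (Set.mem_biUnion hxT hd), hx d hd]

theorem IsSFT.isSofic {G : Type*} [Group G] {n : ℕ} {X : Set (G → Fin n)} (hX : IsSFT X) :
    IsSofic X :=
  ⟨Fin n, inferInstance, X, id, hX,
    ⟨Set.mapsTo_id X, @continuousOn_id _ (prodiscrete G (Fin n)) X, fun _ _ _ => rfl⟩,
    Set.image_id X⟩

/-- The coordinates of a word over the generators, relative to the right cosets of a free
subgroup, are computable. -/
theorem computable_coordinates {G : Type*} [Group G] {k r m : ℕ} (σ : Fin k → G)
    {κ : FreeGroup (Fin r) →* G} {t : Fin m → G}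
    (hκt : Function.Bijective fun p : FreeGroup (Fin r) × Fin m => κ p.1 * t p.2) :
    ∃ f : List (Fin k × Bool) → List (Fin r × Bool) × Fin m, Computable f ∧
      ∀ l, ∃ h : FreeGroup (Fin r), (f l).1 = h.toWord ∧ wordVal σ l = κ h * t (f l).2 := by
  obtain ⟨⟨h₀, i₀⟩, hi₀⟩ := hκt.2 1
  have hstep (p : Fin m × Fin k × Bool) : ∃ q : List (Fin r × Bool) × Fin m,
      t p.1 * wordVal σ [p.2] = κ (FreeGroup.mk q.1) * t q.2 := by
    obtain ⟨⟨h, i⟩, hi⟩ := hκt.2 (t p.1 * wordVal σ [p.2])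
    exact ⟨(h.toWord, i), by rw [← hi, FreeGroup.mk_toWord]⟩
  choose step hstep using hstep
  let run (l : List (Fin k × Bool)) : List (Fin r × Bool) × Fin m :=
    l.foldl (fun s a => (s.1 ++ (step (s.2, a)).1, (step (s.2, a)).2)) (h₀.toWord, i₀)
  have hrun : Primrec run := by
    have hs : Primrec fun p : List (Fin k × Bool) ×
        ((List (Fin r × Bool) × Fin m) × (Fin k × Bool)) => step (p.2.1.2, p.2.2) :=
      (Primrec.dom_finite step).comp
        ((Primrec.snd.comp (Primrec.fst.comp Primrec.snd)).pair (Primrec.snd.comp Primrec.snd))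
    refine Primrec.list_foldl
      (h := fun _ p => (p.1.1 ++ (step (p.1.2, p.2)).1, (step (p.1.2, p.2)).2))
      Primrec.id (Primrec.const _) (Primrec.pair (Primrec.list_append.comp
        (Primrec.fst.comp (Primrec.fst.comp Primrec.snd)) (Primrec.fst.comp hs))
        (Primrec.snd.comp hs)).to₂
  refine ⟨fun l => (FreeGroup.reduce (run l).1, (run l).2),
    (((primrec_reduce_s11 r).comp (Primrec.fst.comp hrun)).pair (Primrec.snd.comp hrun)).to_comp,
    fun l => ⟨FreeGroup.mk (run l).1, rfl, ?_⟩⟩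
  induction l using List.reverseRecOn with
  | nil =>
    simp only [run, List.foldl_nil, FreeGroup.mk_toWord]
    rw [wordVal, ← FreeGroup.one_eq_mk, map_one]
    exact hi₀.symm
  | append_singleton l a ih =>
    have hval : wordVal σ (l ++ [a]) = wordVal σ l * wordVal σ [a] := by
      rw [wordVal, wordVal, wordVal, ← map_mul, FreeGroup.mul_mk]
    have hlast : run (l ++ [a]) =
        ((run l).1 ++ (step ((run l).2, a)).1, (step ((run l).2, a)).2) := by
      simp only [run, List.foldl_append, List.foldl_cons, List.foldl_nil]
    simp only [hlast, hval] at ih ⊢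
    rw [ih, mul_assoc, hstep ((run l).2, a), ← mul_assoc, ← map_mul, FreeGroup.mul_mk]

theorem exists_computablePoint_of_isSofic {G : Type*} [Group G] {k : ℕ} (σ : Fin k → G)
    (hσ : IsSymmGen σ) (hvf : ∃ K : Subgroup G, K.FiniteIndex ∧ IsFreeGroup ↥K)
    {n : ℕ} {X : Set (G → Fin n)} (hX : IsSofic X) (hne : X.Nonempty) :
    ∃ x ∈ pullback (cover σ) X, ComputablePoint x := by
  obtain ⟨r, m, κ, t, hκt⟩ := exists_free_coordinates σ hσ hvf
  obtain ⟨B, hB, Y, φ, hY, ⟨-, hφ, hequiv⟩, rfl⟩ := hX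
  choose D hDfin hD using fun i => exists_finite_window hY.isClosed hφ (t i)
  obtain ⟨N, c, next, q₀, hc, y, hy, hyc⟩ := exists_automatic_configuration hκt hY
    hne.of_image (Set.finite_iUnion hDfin)
  obtain ⟨f, hf, hfspec⟩ := computable_coordinates σ hκt
  refine ⟨_, ⟨φ y, ⟨y, hy, rfl⟩, rfl⟩, computablePoint_of_computable ?_⟩
  have hout : Computable fun l : List (Fin k × Bool) =>
      (fun p : Fin N × Fin m => φ (c p.1) (t p.2)) ((f l).1.foldl next q₀, (f l).2) := by
    have hfold : Primrec fun w : List (Fin r × Bool) => w.foldl next q₀ :=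
      Primrec.list_foldl (h := fun _ p => next p.1 p.2) Primrec.id (Primrec.const q₀)
        ((Primrec.dom_finite fun p : Fin N × Fin r × Bool => next p.1 p.2).comp
          Primrec.snd).to₂
    exact (Primrec.dom_finite fun p : Fin N × Fin m => φ (c p.1) (t p.2)).to_comp.comp
      ((hfold.to_comp.comp (Computable.fst.comp hf)).pair (Computable.snd.comp hf))
  refine hout.of_eq fun l => ?_
  obtain ⟨h, hw, hval⟩ := hfspec l
  change φ (c ((f l).1.foldl next q₀)) (t (f l).2) = φ y (wordVal σ l)
  have hshift : φ y (κ h * t (f l).2) = φ (shift (κ h)⁻¹ y) (t (f l).2) := by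
    rw [hequiv y hy, shift, inv_inv]
  rw [hval, hshift, hw]
  refine hD _ _ (hc _) _ (hY.shift_mem hy _) fun d hd => ?_
  rw [shift, inv_inv, hyc h d (Set.mem_iUnion.2 ⟨_, hd⟩)]

/-- For every finitely generated virtually free group `G`,
`M_SFT(G) = M_sof(G) = {0_M}`: every nonempty SFT and every nonempty sofic subshift on
`G` has trivial Medvedev degree, i.e. its pullback contains a computable configuration. -/
theorem statement11 {G : Type*} [Group G] {k : ℕ} (σ : Fin k → G) (hσ : IsSymmGen σ)
    (hvf : ∃ K : Subgroup G, K.FiniteIndex ∧ IsFreeGroup ↥K) :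
    (∀ P : Set (ℕ → ℕ),
      (IsSFTDeg σ P ↔ IsZeroDeg P) ∧ (IsSoficDeg σ P ↔ IsZeroDeg P)) ∧
    ∀ (n : ℕ) (X : Set (G → Fin n)), IsSofic X → X.Nonempty →
      ∃ x ∈ pullback (cover σ) X, ComputablePoint x := by
  have hsofic (n : ℕ) (X : Set (G → Fin n)) (hX : IsSofic X) (hne : X.Nonempty) :=
    exists_computablePoint_of_isSofic σ hσ hvf hX hne
  have hfull : IsSFT (Set.univ : Set (G → Fin 1)) := ⟨[], by simp⟩
  have hfullzero := isZeroDeg_mSet (exists_computable_fullShift σ)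
  refine ⟨fun P => ⟨⟨?_, fun hP => ?_⟩, ⟨?_, fun hP => ?_⟩⟩, hsofic⟩
  · rintro ⟨n, X, hX, hne, hP⟩
    exact (isZeroDeg_mSet (hsofic n X hX.isSofic hne)).baireEquiv_iff.1 hP
  · exact ⟨1, _, hfull, Set.univ_nonempty, hfullzero.baireEquiv_iff.2 hP⟩
  · rintro ⟨n, X, hX, hne, hP⟩
    exact (isZeroDeg_mSet (hsofic n X hX hne)).baireEquiv_iff.1 hP
  · exact ⟨1, _, hfull.isSofic, Set.univ_nonempty, hfullzero.baireEquiv_iff.2 hP⟩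

end MedvedevFormal
end
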